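/- arXiv:2202.12794 — 2 statements merged into one kernel-verified Lean document; each statement's English description precedes it below -/
import Mathlib

section
/- Let d ≥ 3, γ > d−2 with γ ∉ ℕ, and let f be a function on ℝ^d∖B₁ satisfying ( R^{−d} ∫_{|x|>R} |x|² f(x)² dx )^{1/2} ≤ R^{−(γ+1)} for all R ≥ 1. Then there exists a function u such that Δu = f in ℝ^d∖B₁ and ( R^{−d} ∫_{|x|≥R} |u(x)|²/|x|² dx )^{1/2} ≤ C R^{−(γ+1)} for all R ≥ 1, where the constant C depends only on d and γ. -/
open MeasureTheory Filter Metric Real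
open scoped ENNReal NNReal Topology

noncomputable section

/-- `d`-dimensional Euclidean space. -/
abbrev Ed (d : ℕ) : Type := EuclideanSpace ℝ (Fin d)

/-- The Laplacian `Δu = Σ_i ∂²_{ii} u` of a scalar function on `ℝ^d`. -/
def lapScalar (d : ℕ) (u : Ed d → ℝ) (x : Ed d) : ℝ :=
  ∑ i : Fin d, iteratedFDeriv ℝ 2 u x (fun _ => EuclideanSpace.single i (1 : ℝ))

/-! ### Pointwise Laplacians -/

/-- `u` is differentiable near `x`, twice differentiable at `x`, and its Laplacian there is `L`. -/
def HasLaplacianAt {d : ℕ} (u : Ed d → ℝ) (L : ℝ) (x : Ed d) : Prop :=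
  ∃ (u' : Ed d → Ed d →L[ℝ] ℝ) (u'' : Ed d →L[ℝ] Ed d →L[ℝ] ℝ),
    (∀ᶠ y in 𝓝 x, HasFDerivAt u (u' y) y) ∧ HasFDerivAt u' u'' x ∧
      ∑ i : Fin d, u'' (EuclideanSpace.single i 1) (EuclideanSpace.single i 1) = L

namespace HasLaplacianAt

variable {d : ℕ} {u v : Ed d → ℝ} {L M : ℝ} {x : Ed d}

theorem lapScalar_eq (h : HasLaplacianAt u L x) : lapScalar d u x = L := by
  obtain ⟨u', u'', h1, h2, h3⟩ := h
  have e : fderiv ℝ u =ᶠ[𝓝 x] u' := h1.mono fun y hy => hy.fderiv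
  have e2 : fderiv ℝ (fderiv ℝ u) x = u'' := by rw [e.fderiv_eq, h2.fderiv]
  simp only [lapScalar, iteratedFDeriv_two_apply, e2, h3]

theorem add (h : HasLaplacianAt u L x) (h' : HasLaplacianAt v M x) :
    HasLaplacianAt (fun y => u y + v y) (L + M) x := by
  obtain ⟨u', u'', h1, h2, h3⟩ := h
  obtain ⟨v', v'', k1, k2, k3⟩ := h'
  refine ⟨fun y => u' y + v' y, u'' + v'', ?_, h2.fun_add k2, ?_⟩
  · filter_upwards [h1, k1] with y hy ky using hy.fun_add ky
  · simp [Finset.sum_add_distrib, ← h3, ← k3]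

theorem const_mul (c : ℝ) (h : HasLaplacianAt u L x) :
    HasLaplacianAt (fun y => c * u y) (c * L) x := by
  obtain ⟨u', u'', h1, h2, h3⟩ := h
  refine ⟨fun y => c • u' y, c • u'', ?_, h2.fun_const_smul c, ?_⟩
  · filter_upwards [h1] with y hy using hy.const_mul c
  · simp [Finset.mul_sum, ← h3]

theorem sum {ι : Type*} (s : Finset ι) {w : ι → Ed d → ℝ} {N : ι → ℝ}
    (h : ∀ i ∈ s, HasLaplacianAt (w i) (N i) x) :
    HasLaplacianAt (fun y => ∑ i ∈ s, w i y) (∑ i ∈ s, N i) x := by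
  classical
  induction s using Finset.induction_on with
  | empty =>
    exact ⟨0, 0, by simpa using Eventually.of_forall fun y => hasFDerivAt_const (0 : ℝ) y,
      hasFDerivAt_const (0 : Ed d →L[ℝ] ℝ) x, by simp⟩
  | insert a s ha ih =>
    simp only [Finset.sum_insert ha]
    exact (h a (by simp)).add (ih fun i hi => h i (by simp [hi]))

theorem congr_of_eventuallyEq (h : HasLaplacianAt u L x) (e : v =ᶠ[𝓝 x] u) :
    HasLaplacianAt v L x := by
  obtain ⟨u', u'', h1, h2, h3⟩ := h
  refine ⟨u', u'', ?_, h2, h3⟩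
  filter_upwards [h1, e.eventuallyEq_nhds] with y hy ey using hy.congr_of_eventuallyEq ey

end HasLaplacianAt

theorem lapScalar_eq_laplacian {d : ℕ} (u : Ed d → ℝ) (x : Ed d) :
    lapScalar d u x = Laplacian.laplacian u x := by
  rw [InnerProductSpace.laplacian_eq_iteratedFDeriv_orthonormalBasis u
    (EuclideanSpace.basisFun (Fin d) ℝ)]
  simp only [lapScalar, iteratedFDeriv_two_apply]
  simp

theorem ContDiffAt.hasLaplacianAt {d : ℕ} {u : Ed d → ℝ} {x : Ed d} (h : ContDiffAt ℝ 2 u x) :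
    HasLaplacianAt u (Laplacian.laplacian u x) x := by
  refine ⟨fderiv ℝ u, fderiv ℝ (fderiv ℝ u) x, ?_, ?_, ?_⟩
  · filter_upwards [h.eventually (by simp)] with y hy
    exact (hy.differentiableAt (by simp)).hasFDerivAt
  · exact ((h.fderiv_right (m := 1) (by norm_num)).differentiableAt (by simp)).hasFDerivAt
  · rw [← lapScalar_eq_laplacian]
    simp [lapScalar, iteratedFDeriv_two_apply]

/-! ### The fundamental solution and its regularization -/

/-- `(ε + |x|²)^{1 - d/2}`; for `ε = 0` this is the fundamental solution up to a constant. -/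
def newtonKernel (d : ℕ) (ε : ℝ) (x : Ed d) : ℝ := (ε + ‖x‖ ^ 2) ^ (1 - (d : ℝ) / 2)

section Kernel

variable {d : ℕ} {ε : ℝ} {x : Ed d}

theorem newtonKernel_zero (x : Ed d) : newtonKernel d 0 x = ‖x‖ ^ (2 - (d : ℝ)) := by
  rw [newtonKernel, zero_add, ← Real.rpow_natCast, ← Real.rpow_mul (norm_nonneg _)]
  congr 1; push_cast; ring

theorem contDiffAt_newtonKernel {n : WithTop ℕ∞} (h : 0 < ε + ‖x‖ ^ 2) :
    ContDiffAt ℝ n (newtonKernel d ε) x := by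
  unfold newtonKernel
  exact (contDiffAt_const.add (contDiff_norm_sq ℝ).contDiffAt).rpow_const_of_ne h.ne'

theorem hasFDerivAt_rpow_norm_sq (p : ℝ) (h : 0 < ε + ‖x‖ ^ 2) :
    HasFDerivAt (fun y : Ed d => (ε + ‖y‖ ^ 2) ^ p)
      ((2 * p * (ε + ‖x‖ ^ 2) ^ (p - 1)) • innerSL ℝ x) x := by
  have h1 : HasFDerivAt (fun y : Ed d => ε + ‖y‖ ^ 2) (2 • innerSL ℝ x) x :=
    ((hasStrictFDerivAt_norm_sq x).hasFDerivAt).const_add ε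
  refine (h1.rpow_const (p := p) (Or.inl h.ne')).congr_fderiv ?_
  ext v
  simp only [smul_apply, smul_eq_mul, nsmul_eq_mul]
  push_cast
  ring

theorem hasLaplacianAt_newtonKernel (h : 0 < ε + ‖x‖ ^ 2) :
    HasLaplacianAt (newtonKernel d ε)
      ((2 - (d : ℝ)) * d * ε * (ε + ‖x‖ ^ 2) ^ (-1 - (d : ℝ) / 2)) x := by
  have hev : ∀ᶠ y in 𝓝 x, 0 < ε + ‖y‖ ^ 2 :=
    (by fun_prop : ContinuousAt (fun y : Ed d => ε + ‖y‖ ^ 2) x).eventually (lt_mem_nhds h)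
  refine ⟨_, _, hev.mono fun y hy => hasFDerivAt_rpow_norm_sq _ hy,
    ((hasFDerivAt_rpow_norm_sq (1 - (d : ℝ) / 2 - 1) h).const_mul
      (2 * (1 - (d : ℝ) / 2))).smul (innerSL ℝ).hasFDerivAt, ?_⟩
  have hs : ∑ i : Fin d, x i * x i = ‖x‖ ^ 2 := by
    rw [EuclideanSpace.norm_sq_eq]
    simp [sq]
  have hp : (ε + ‖x‖ ^ 2) ^ (1 - (d : ℝ) / 2 - 1) =
      (ε + ‖x‖ ^ 2) ^ (-1 - (d : ℝ) / 2) * (ε + ‖x‖ ^ 2) := by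
    rw [← Real.rpow_add_one h.ne']; congr 1; ring
  have hp' : (1 - (d : ℝ) / 2 - 1 - 1) = (-1 - (d : ℝ) / 2) := by ring
  have hin : ∀ (y : Ed d) (i : Fin d), innerSL ℝ y (EuclideanSpace.single i 1) = y i := by
    intro y i
    rw [innerSL_apply_apply, EuclideanSpace.inner_single_right]
    simp
  simp only [add_apply, smul_apply,
    ContinuousLinearMap.smulRight_apply, hin, smul_eq_mul, Finset.sum_add_distrib]
  rw [hp', hp]
  have h2 : ∀ i : Fin d, 2 * (1 - (d : ℝ) / 2) * (2 * (1 - (d : ℝ) / 2 - 1) *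
      (ε + ‖x‖ ^ 2) ^ (-1 - (d : ℝ) / 2) * x i) * x i =
      (-(2 - (d : ℝ)) * d * (ε + ‖x‖ ^ 2) ^ (-1 - (d : ℝ) / 2)) * (x i * x i) := by
    intro i; ring
  simp only [h2, ← Finset.mul_sum, hs]
  simp
  ring

end Kernel

/-! ### The Newtonian potential of a test function -/

theorem measurable_newtonKernel (d : ℕ) (ε : ℝ) : Measurable (newtonKernel d ε) := by
  unfold newtonKernel; fun_prop

theorem locallyIntegrable_newtonKernel {d : ℕ} (hd : 3 ≤ d) :
    LocallyIntegrable (newtonKernel d 0) := by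
  refine locallyIntegrable_of_norm_le_rpow (C := 1) (α := (d : ℝ) - 2) ?_ ?_ ?_
    (measurable_newtonKernel d 0).aestronglyMeasurable
  · simp; omega
  · simp
  · refine Eventually.of_forall fun x => ?_
    rw [newtonKernel_zero, Real.norm_of_nonneg (by positivity), one_mul, neg_sub]

theorem lapScalar_eq_sum_fderiv {d : ℕ} {φ : Ed d → ℝ} (h : ContDiff ℝ 2 φ) (x : Ed d) :
    lapScalar d φ x = ∑ i : Fin d,
      fderiv ℝ (fun y => fderiv ℝ φ y (EuclideanSpace.single i 1)) x
        (EuclideanSpace.single i 1) := by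
  have h1 : DifferentiableAt ℝ (fderiv ℝ φ) x :=
    ((h.fderiv_right (m := 1) (by norm_num)).differentiable (by simp)) x
  simp only [lapScalar, iteratedFDeriv_two_apply]
  refine Finset.sum_congr rfl fun i _ => ?_
  rw [fderiv_clm_apply h1 (by fun_prop)]
  simp

theorem continuous_lapScalar {d : ℕ} {φ : Ed d → ℝ} (h : ContDiff ℝ 2 φ) :
    Continuous (lapScalar d φ) := by
  unfold lapScalar
  refine continuous_finsetSum _ fun i _ => ?_
  have := h.continuous_iteratedFDeriv (m := 2) le_rfl
  fun_prop

theorem HasCompactSupport.lapScalar {d : ℕ} {φ : Ed d → ℝ} (h : HasCompactSupport φ) :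
    HasCompactSupport (lapScalar d φ) := by
  refine (h.iteratedFDeriv (𝕜 := ℝ) 2).mono fun x hx => ?_
  contrapose! hx
  simp only [Function.mem_support, not_not] at hx ⊢
  simp [_root_.lapScalar, hx]

theorem integral_mul_lapScalar {d : ℕ} {G φ : Ed d → ℝ} (hG : ContDiff ℝ 2 G)
    (hφ : ContDiff ℝ 2 φ) (hc : HasCompactSupport φ) :
    ∫ x, G x * lapScalar d φ x = ∫ x, lapScalar d G x * φ x := by
  have key : ∀ {w : Ed d → ℝ}, ContDiff ℝ 2 w → ∀ v, ContDiff ℝ 1 (fun y => fderiv ℝ w y v) :=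
    fun hw v => (hw.fderiv_right (m := 1) (by norm_num)).clm_apply contDiff_const
  have cont : ∀ {w : Ed d → ℝ}, ContDiff ℝ 1 w → ∀ v, Continuous (fun y => fderiv ℝ w y v) :=
    fun hw v => (hw.continuous_fderiv (by simp)).clm_apply continuous_const
  simp only [lapScalar_eq_sum_fderiv hG, lapScalar_eq_sum_fderiv hφ, Finset.mul_sum,
    Finset.sum_mul]
  have i1 : ∀ v, Integrable (fun x => G x * fderiv ℝ (fun y => fderiv ℝ φ y v) x v) := fun v =>
    (hG.continuous.mul (cont (key hφ v) v)).integrable_of_hasCompactSupport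
      (((hc.fderiv_apply ℝ v).fderiv_apply ℝ v).mul_left)
  have i2 : ∀ v, Integrable (fun x => fderiv ℝ (fun y => fderiv ℝ G y v) x v * φ x) := fun v =>
    ((cont (key hG v) v).mul hφ.continuous).integrable_of_hasCompactSupport hc.mul_left
  have i3 : ∀ v, Integrable (fun x => fderiv ℝ G x v * fderiv ℝ φ x v) := fun v =>
    ((key hG v).continuous.mul (key hφ v).continuous).integrable_of_hasCompactSupport
      (hc.fderiv_apply ℝ v).mul_left
  rw [integral_finsetSum _ fun i _ => i1 _, integral_finsetSum _ fun i _ => i2 _]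
  refine Finset.sum_congr rfl fun i _ => ?_
  rw [integral_mul_fderiv_eq_neg_fderiv_mul_of_integrable (i3 _) (i1 _)
      ((hG.continuous.mul (key hφ _).continuous).integrable_of_hasCompactSupport
        (hc.fderiv_apply ℝ _).mul_left)
      (fun x _ => (hG.differentiable (by simp)) x)
      (fun x _ => ((key hφ _).differentiable (by simp)) x),
    integral_mul_fderiv_eq_neg_fderiv_mul_of_integrable (i2 _) (i3 _)
      (((key hG _).continuous.mul hφ.continuous).integrable_of_hasCompactSupport hc.mul_left)
      (fun x _ => ((key hG _).differentiable (by simp)) x)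
      (fun x _ => (hφ.differentiable (by simp)) x), neg_neg]

/-- The constant `κ` for which `-κ δ₀` is the Laplacian of `|x|^{2-d}`. -/
def newtonConst (d : ℕ) : ℝ :=
  ((d : ℝ) - 2) * d * ∫ w : Ed d, (1 + ‖w‖ ^ 2) ^ (-1 - (d : ℝ) / 2)

theorem integrable_newtonDensity (d : ℕ) :
    Integrable (fun w : Ed d => (1 + ‖w‖ ^ 2) ^ (-1 - (d : ℝ) / 2)) := by
  have := integrable_rpow_neg_one_add_norm_sq (E := Ed d) (μ := volume) (r := (d : ℝ) + 2)
    (by simp)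
  refine this.congr (Eventually.of_forall fun x => ?_)
  dsimp only; congr 1; ring

theorem newtonConst_pos {d : ℕ} (hd : 3 ≤ d) : 0 < newtonConst d := by
  have h3 : (3 : ℝ) ≤ d := by exact_mod_cast hd
  refine mul_pos (mul_pos (by linarith) (by linarith)) ?_
  rw [integral_pos_iff_support_of_nonneg (fun w => by positivity) (integrable_newtonDensity d)]
  have : Function.support (fun w : Ed d => (1 + ‖w‖ ^ 2) ^ (-1 - (d : ℝ) / 2)) = Set.univ := by
    ext w
    simp only [Function.mem_support, Set.mem_univ, iff_true]
    positivity
  rw [this]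
  exact Measure.measure_univ_pos.2 (NeZero.ne volume)

theorem integral_newtonKernel_sq_mul_lapScalar {d : ℕ} {φ : Ed d → ℝ} (hφ : ContDiff ℝ 2 φ)
    (hc : HasCompactSupport φ) {s : ℝ} (hs : 0 < s) :
    ∫ x, newtonKernel d (s ^ 2) x * lapScalar d φ x =
      ∫ w, (2 - (d : ℝ)) * d * (1 + ‖w‖ ^ 2) ^ (-1 - (d : ℝ) / 2) * φ (s • w) := by
  have hG : ContDiff ℝ 2 (newtonKernel d (s ^ 2)) :=
    contDiff_iff_contDiffAt.2 fun x => contDiffAt_newtonKernel (by positivity)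
  rw [integral_mul_lapScalar hG hφ hc]
  have e : ∀ w : Ed d, (2 - (d : ℝ)) * d * (1 + ‖w‖ ^ 2) ^ (-1 - (d : ℝ) / 2) * φ (s • w) =
      s ^ d * (lapScalar d (newtonKernel d (s ^ 2)) (s • w) * φ (s • w)) := by
    intro w
    have h1 : s ^ 2 + ‖s • w‖ ^ 2 = s ^ 2 * (1 + ‖w‖ ^ 2) := by
      rw [norm_smul, Real.norm_of_nonneg hs.le]; ring
    have h2 : (s ^ 2) ^ (-1 - (d : ℝ) / 2) * s ^ 2 * s ^ d = 1 := by
      rw [← Real.rpow_natCast s 2, ← Real.rpow_natCast s d, ← Real.rpow_mul hs.le,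
        ← Real.rpow_add hs, ← Real.rpow_add hs]
      convert Real.rpow_zero s using 2
      push_cast; ring
    rw [(hasLaplacianAt_newtonKernel (by positivity)).lapScalar_eq, h1,
      Real.mul_rpow (by positivity) (by positivity)]
    linear_combination (-(2 - (d : ℝ)) * d * (1 + ‖w‖ ^ 2) ^ (-1 - (d : ℝ) / 2) * φ (s • w)) * h2
  simp only [e]
  rw [integral_const_mul, Measure.integral_comp_smul volume
    (fun x => lapScalar d (newtonKernel d (s ^ 2)) x * φ x)]
  rw [abs_of_pos (by positivity), finrank_euclideanSpace, Fintype.card_fin, smul_eq_mul,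
    ← mul_assoc, mul_inv_cancel₀ (by positivity), one_mul]

theorem integrable_newtonKernel_mul {d : ℕ} (hd : 3 ≤ d) {g : Ed d → ℝ} (hg : Continuous g)
    (hc : HasCompactSupport g) : Integrable (fun x => newtonKernel d 0 x * g x) := by
  have := (locallyIntegrable_newtonKernel hd).integrable_smul_right_of_hasCompactSupport hg hc
  simpa using this

theorem integral_newtonKernel_mul_lapScalar {d : ℕ} (hd : 3 ≤ d) {φ : Ed d → ℝ}
    (hφ : ContDiff ℝ 2 φ) (hc : HasCompactSupport φ) :
    ∫ x, newtonKernel d 0 x * lapScalar d φ x = -newtonConst d * φ 0 := by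
  have h3 : (3 : ℝ) ≤ d := by exact_mod_cast hd
  have : NeZero d := ⟨by omega⟩
  have l1 : Tendsto (fun s : ℝ => ∫ x, newtonKernel d (s ^ 2) x * lapScalar d φ x) (𝓝[>] 0)
      (𝓝 (∫ x, newtonKernel d 0 x * lapScalar d φ x)) := by
    refine tendsto_integral_filter_of_dominated_convergence
      (fun x => ‖newtonKernel d 0 x * lapScalar d φ x‖) ?_ ?_
      (integrable_newtonKernel_mul hd (continuous_lapScalar hφ) hc.lapScalar).norm ?_
    · exact Eventually.of_forall fun s => ((measurable_newtonKernel d _).mul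
        (continuous_lapScalar hφ).measurable).aestronglyMeasurable
    · refine Eventually.of_forall fun s => ?_
      filter_upwards [Measure.ae_ne volume (0 : Ed d)] with x hx
      have hx' : 0 < ‖x‖ := norm_pos_iff.2 hx
      rw [norm_mul, norm_mul]
      refine mul_le_mul_of_nonneg_right ?_ (norm_nonneg _)
      unfold newtonKernel
      rw [Real.norm_of_nonneg (by positivity), Real.norm_of_nonneg (by positivity)]
      exact Real.rpow_le_rpow_of_nonpos (by positivity) (by nlinarith [sq_nonneg s])
        (by linarith)
    · filter_upwards [Measure.ae_ne volume (0 : Ed d)] with x hx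
      have hx' : 0 < ‖x‖ := norm_pos_iff.2 hx
      refine Tendsto.mul_const _ (tendsto_nhdsWithin_of_tendsto_nhds ?_)
      have hcont : ContinuousAt (fun s : ℝ => newtonKernel d (s ^ 2) x) 0 := by
        unfold newtonKernel
        refine ContinuousAt.rpow_const (by fun_prop) (Or.inl (by positivity))
      simpa [ContinuousAt] using hcont
  obtain ⟨M, hM⟩ := hc.exists_bound_of_continuous hφ.continuous
  have h_int := (integrable_newtonDensity d).const_mul ((2 - (d : ℝ)) * d)
  have l2 : Tendsto (fun s : ℝ => ∫ w : Ed d,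
      (2 - (d : ℝ)) * d * (1 + ‖w‖ ^ 2) ^ (-1 - (d : ℝ) / 2) * φ (s • w)) (𝓝[>] 0)
      (𝓝 (∫ w : Ed d, (2 - (d : ℝ)) * d * (1 + ‖w‖ ^ 2) ^ (-1 - (d : ℝ) / 2) * φ 0)) := by
    refine tendsto_integral_filter_of_dominated_convergence
      (fun w => ‖(2 - (d : ℝ)) * d * (1 + ‖w‖ ^ 2) ^ (-1 - (d : ℝ) / 2)‖ * M) ?_ ?_
      (h_int.norm.mul_const M) ?_
    · have := hφ.continuous
      exact Eventually.of_forall fun s =>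
        h_int.aestronglyMeasurable.mul (by fun_prop : Continuous _).aestronglyMeasurable
    · refine Eventually.of_forall fun s => Eventually.of_forall fun w => ?_
      rw [norm_mul]
      exact mul_le_mul_of_nonneg_left (hM _) (norm_nonneg _)
    · refine Eventually.of_forall fun w => ?_
      refine Tendsto.const_mul _ (tendsto_nhdsWithin_of_tendsto_nhds ?_)
      have := hφ.continuous
      have hcont : Continuous fun s : ℝ => φ (s • w) := by fun_prop
      simpa using hcont.tendsto 0
  have e : (fun s : ℝ => ∫ x, newtonKernel d (s ^ 2) x * lapScalar d φ x) =ᶠ[𝓝[>] 0]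
      fun s : ℝ => ∫ w : Ed d,
        (2 - (d : ℝ)) * d * (1 + ‖w‖ ^ 2) ^ (-1 - (d : ℝ) / 2) * φ (s • w) := by
    filter_upwards [self_mem_nhdsWithin] with s hs
    exact integral_newtonKernel_sq_mul_lapScalar hφ hc hs
  rw [tendsto_nhds_unique (l1.congr' e) l2, integral_mul_const, integral_const_mul, newtonConst]
  ring

theorem hasFDerivAt_integral_smul_sub {d : ℕ} {F : Type*} [NormedAddCommGroup F]
    [NormedSpace ℝ F] [CompleteSpace F] {k : Ed d → ℝ} (hk : LocallyIntegrable k)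
    {g : Ed d → F} (hg : ContDiff ℝ 1 g) (hc : HasCompactSupport g) (x : Ed d) :
    HasFDerivAt (fun x => ∫ z, k z • g (x - z)) (∫ z, k z • fderiv ℝ g (x - z)) x := by
  have := hc.hasFDerivAt_convolution_right (ContinuousLinearMap.lsmul ℝ ℝ) hk hg x
  exact this

set_option maxSynthPendingDepth 3 in
/-- The Newtonian potential of a test function solves Poisson's equation. -/
theorem hasLaplacianAt_newtonPotential {d : ℕ} (hd : 3 ≤ d) {φ : Ed d → ℝ}
    (hφ : ContDiff ℝ 2 φ) (hc : HasCompactSupport φ) (x : Ed d) :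
    HasLaplacianAt (fun x => ∫ y, newtonKernel d 0 (x - y) * φ y) (-newtonConst d * φ x) x := by
  have hk := locallyIntegrable_newtonKernel hd
  have hφ' : ContDiff ℝ 1 (fderiv ℝ φ) := hφ.fderiv_right (by norm_num)
  have hcφ' : HasCompactSupport (fderiv ℝ φ) := hc.fderiv ℝ
  have e : (fun x => ∫ y, newtonKernel d 0 (x - y) * φ y) =
      fun x => ∫ z, newtonKernel d 0 z • φ (x - z) := by
    ext x
    rw [← integral_sub_left_eq_self _ volume x]
    simp
  rw [e]
  refine ⟨_, _, Eventually.of_forall fun y =>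
    hasFDerivAt_integral_smul_sub hk (hφ.of_le (by norm_num)) hc y,
    hasFDerivAt_integral_smul_sub hk hφ' hcφ' x, ?_⟩
  have hc2 : HasCompactSupport (fderiv ℝ (fderiv ℝ φ)) := hcφ'.fderiv ℝ
  have hcont : Continuous (fderiv ℝ (fderiv ℝ φ)) := hφ'.continuous_fderiv (by simp)
  have h_int : Integrable fun z => newtonKernel d 0 z • fderiv ℝ (fderiv ℝ φ) (x - z) :=
    hk.integrable_smul_right_of_hasCompactSupport (by fun_prop)
      (hc2.comp_homeomorph (Homeomorph.subLeft x))
  have happ : ∀ v : Ed d, Integrable fun z =>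
      newtonKernel d 0 z * fderiv ℝ (fderiv ℝ φ) (x - z) v v := fun v => by
    have := (h_int.apply_continuousLinearMap v).apply_continuousLinearMap v
    simpa using this
  have h1 : ∀ v : Ed d, (∫ z, newtonKernel d 0 z • fderiv ℝ (fderiv ℝ φ) (x - z)) v v =
      ∫ z, newtonKernel d 0 z * fderiv ℝ (fderiv ℝ φ) (x - z) v v := fun v => by
    rw [ContinuousLinearMap.integral_apply h_int, ContinuousLinearMap.integral_apply
      (h_int.apply_continuousLinearMap v)]
    simp
  simp only [h1]
  rw [← integral_finsetSum _ fun i _ => happ _]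
  have hψ : ContDiff ℝ 2 (fun z => φ (x - z)) := hφ.comp (contDiff_const.sub contDiff_id)
  have h2 : ∀ z, lapScalar d (fun z => φ (x - z)) z = lapScalar d φ (x - z) := fun z => by
    have hs : ∀ y : Ed d, HasFDerivAt (fun z : Ed d => x - z) (-ContinuousLinearMap.id ℝ _) y :=
      fun y => (hasFDerivAt_id y).const_sub x
    refine HasLaplacianAt.lapScalar_eq ⟨fun z => -fderiv ℝ φ (x - z),
      fderiv ℝ (fderiv ℝ φ) (x - z), Eventually.of_forall fun y => ?_, ?_, ?_⟩
    · exact (((hφ.differentiable (by simp)) (x - y)).hasFDerivAt.comp y (hs y)).congr_fderiv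
        (by ext; simp)
    · exact (((hφ'.differentiable (by simp)) (x - z)).hasFDerivAt.comp z (hs z)).neg.congr_fderiv
        (by ext; simp)
    · simp [lapScalar, iteratedFDeriv_two_apply]
  have h3 := integral_newtonKernel_mul_lapScalar hd hψ
    (hc.comp_homeomorph (Homeomorph.subLeft x))
  simp only [h2, sub_zero] at h3
  rw [← h3]
  refine integral_congr_ae (Eventually.of_forall fun z => ?_)
  simp [lapScalar, iteratedFDeriv_two_apply, Finset.mul_sum]

/-! ### Derivatives of the Newtonian kernel -/

theorem laplacian_fderiv_eq_zero {d : ℕ} {F : Type*} [NormedAddCommGroup F] [NormedSpace ℝ F]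
    [CompleteSpace F] {f : Ed d → F} {x : Ed d} (hf : ContDiffAt ℝ ⊤ f x)
    (h0 : ∀ᶠ y in 𝓝 x, Laplacian.laplacian f y = 0) :
    Laplacian.laplacian (fderiv ℝ f) x = 0 := by
  have hb : ∀ {G : Type _} [NormedAddCommGroup G] [NormedSpace ℝ G] (g : Ed d → G) (y : Ed d),
      Laplacian.laplacian g y = ∑ i, iteratedFDeriv ℝ 2 g y
        ![EuclideanSpace.basisFun (Fin d) ℝ i, EuclideanSpace.basisFun (Fin d) ℝ i] :=
    fun g y => by
      rw [InnerProductSpace.laplacian_eq_iteratedFDeriv_orthonormalBasis g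
        (EuclideanSpace.basisFun (Fin d) ℝ)]
  have hd2 : DifferentiableAt ℝ (iteratedFDeriv ℝ 2 f) x :=
    hf.differentiableAt_iteratedFDeriv (WithTop.coe_lt_top _)
  have h1 : HasFDerivAt (Laplacian.laplacian f) (∑ i, (ContinuousMultilinearMap.apply ℝ _ F
      ![EuclideanSpace.basisFun (Fin d) ℝ i, EuclideanSpace.basisFun (Fin d) ℝ i]).comp
        (fderiv ℝ (iteratedFDeriv ℝ 2 f) x)) x := by
    have : Laplacian.laplacian f = fun y => ∑ i, iteratedFDeriv ℝ 2 f y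
      ![EuclideanSpace.basisFun (Fin d) ℝ i, EuclideanSpace.basisFun (Fin d) ℝ i] := funext (hb f)
    rw [this]
    exact HasFDerivAt.fun_sum fun i _ =>
      (ContinuousMultilinearMap.apply ℝ (fun _ : Fin 2 => Ed d) F
        ![EuclideanSpace.basisFun (Fin d) ℝ i, EuclideanSpace.basisFun (Fin d) ℝ i]).hasFDerivAt.comp
          x hd2.hasFDerivAt
  have h2 : HasFDerivAt (Laplacian.laplacian f) (0 : Ed d →L[ℝ] F) x :=
    (hasFDerivAt_const (0 : F) x).congr_of_eventuallyEq h0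
  have h3 := h1.unique h2
  ext v
  rw [hb]
  have h4 := congrArg (fun l => l v) h3
  simp only [sum_apply, ContinuousLinearMap.comp_apply, zero_apply] at h4 ⊢
  rw [← h4]
  refine Finset.sum_congr rfl fun i _ => ?_
  set e := EuclideanSpace.basisFun (Fin d) ℝ i
  have hl := iteratedFDeriv_succ_apply_left (𝕜 := ℝ) (f := f) (x := x) (n := 2) ![v, e, e]
  have hr := iteratedFDeriv_succ_apply_right (𝕜 := ℝ) (f := f) (x := x) (n := 2) ![e, e, v]
  have hs := hf.iteratedFDeriv_comp_perm ![v, e, e] (finRotate 3)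
  have hp : ![v, e, e] ∘ finRotate 3 = ![e, e, v] := by
    ext j; fin_cases j <;> rfl
  have t1 : Fin.tail ![v, e, e] = ![e, e] := by ext j; fin_cases j <;> rfl
  have t2 : Fin.init ![e, e, v] = ![e, e] := by ext j; fin_cases j <;> rfl
  simp only [hp, t1, t2] at hs hl hr
  rw [hr, hl] at hs
  exact hs

theorem zero_add_norm_sq_pos {d : ℕ} {x : Ed d} (hx : x ≠ 0) : 0 < 0 + ‖x‖ ^ 2 := by
  have := norm_pos_iff.2 hx
  positivity

theorem contDiffAt_iteratedFDeriv_newtonKernel {d : ℕ} {x : Ed d} (hx : x ≠ 0) (k : ℕ) :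
    ContDiffAt ℝ ⊤ (iteratedFDeriv ℝ k (newtonKernel d 0)) x :=
  (contDiffAt_newtonKernel (n := ⊤) (zero_add_norm_sq_pos hx)).iteratedFDeriv_right
    (by simp)

theorem laplacian_iteratedFDeriv_newtonKernel {d : ℕ} (k : ℕ) {x : Ed d} (hx : x ≠ 0) :
    Laplacian.laplacian (iteratedFDeriv ℝ k (newtonKernel d 0)) x = 0 := by
  induction k generalizing x with
  | zero =>
    have h1 := (hasLaplacianAt_newtonKernel (zero_add_norm_sq_pos hx)).lapScalar_eq
    rw [lapScalar_eq_laplacian] at h1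
    have h2 := InnerProductSpace.laplacian_CLE_comp_left (f := newtonKernel d 0)
      (l := (continuousMultilinearCurryFin0 ℝ (Ed d) ℝ).symm.toContinuousLinearEquiv)
    refine (congrFun h2 x).trans ?_
    rw [Function.comp_apply, h1, mul_zero, zero_mul, map_zero]
  | succ k ih =>
    have h2 := InnerProductSpace.laplacian_CLE_comp_left
      (f := fderiv ℝ (iteratedFDeriv ℝ k (newtonKernel d 0)))
      (l := (continuousMultilinearCurryLeftEquiv ℝ (fun _ : Fin (k + 1) => Ed d)
        ℝ).symm.toContinuousLinearEquiv)
    refine (congrFun h2 x).trans ?_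
    rw [Function.comp_apply,
      laplacian_fderiv_eq_zero (contDiffAt_iteratedFDeriv_newtonKernel hx k), map_zero]
    filter_upwards [isOpen_compl_singleton.mem_nhds hx] with y hy using ih hy

theorem newtonKernel_smul {d : ℕ} {t : ℝ} (ht : 0 < t) (x : Ed d) :
    newtonKernel d 0 (t • x) = t ^ (2 - (d : ℝ)) * newtonKernel d 0 x := by
  rw [newtonKernel_zero, newtonKernel_zero, norm_smul, Real.norm_of_nonneg ht.le,
    mul_rpow ht.le (norm_nonneg _)]

theorem norm_iteratedFDeriv_newtonKernel_smul_le {d : ℕ} {t : ℝ} (ht : 0 < t) (k : ℕ)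
    {x : Ed d} (hx : x ≠ 0) : t ^ (2 - (d : ℝ)) * ‖iteratedFDeriv ℝ k (newtonKernel d 0) x‖ ≤
      ‖iteratedFDeriv ℝ k (newtonKernel d 0) (t • x)‖ * t ^ k := by
  let g : Ed d ≃L[ℝ] Ed d := ContinuousLinearEquiv.smulLeft (Units.mk0 t ht.ne')
  have h1 := g.iteratedFDerivWithin_comp_right (newtonKernel d 0) uniqueDiffOn_univ
    (x := x) (Set.mem_univ _) k
  have h2 : newtonKernel d 0 ∘ g = t ^ (2 - (d : ℝ)) • newtonKernel d 0 := by
    ext y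
    exact newtonKernel_smul ht y
  rw [Set.preimage_univ, iteratedFDerivWithin_univ, iteratedFDerivWithin_univ, h2,
    iteratedFDeriv_const_smul_apply
      (contDiffAt_newtonKernel (zero_add_norm_sq_pos hx))] at h1
  have h3 := congrArg norm h1
  rw [norm_smul, Real.norm_of_nonneg (by positivity)] at h3
  rw [h3]
  refine (ContinuousMultilinearMap.norm_compContinuousLinearMap_le _ _).trans ?_
  refine mul_le_mul_of_nonneg_left ?_ (norm_nonneg _)
  rw [Finset.prod_const, Finset.card_univ, Fintype.card_fin]
  refine pow_le_pow_left₀ (norm_nonneg _) ?_ _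
  refine ContinuousLinearMap.opNorm_le_bound _ ht.le fun y => ?_
  change ‖t • y‖ ≤ _
  rw [norm_smul, Real.norm_of_nonneg ht.le]

theorem exists_norm_iteratedFDeriv_newtonKernel_le (d k : ℕ) :
    ∃ C : ℝ, 0 ≤ C ∧ ∀ x : Ed d, x ≠ 0 →
      ‖iteratedFDeriv ℝ k (newtonKernel d 0) x‖ ≤ C * ‖x‖ ^ (2 - (d : ℝ) - k) := by
  have hc : ContinuousOn (iteratedFDeriv ℝ k (newtonKernel d 0)) (sphere 0 1) := fun x hx =>
    (contDiffAt_iteratedFDeriv_newtonKernel (by rintro rfl; simp at hx) k).continuousAt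
      |>.continuousWithinAt
  obtain ⟨C, hC⟩ := (isCompact_sphere (0 : Ed d) 1).exists_bound_of_continuousOn hc
  refine ⟨max C 0, le_max_right _ _, fun x hx => ?_⟩
  have hn : 0 < ‖x‖ := norm_pos_iff.2 hx
  have h1 := norm_iteratedFDeriv_newtonKernel_smul_le (inv_pos.2 hn) k hx
  have h2 : ‖iteratedFDeriv ℝ k (newtonKernel d 0) (‖x‖⁻¹ • x)‖ ≤ max C 0 :=
    (hC _ (by simp [norm_smul, hn.ne'])).trans (le_max_left _ _)
  have h3 : ‖x‖⁻¹ ^ (2 - (d : ℝ)) * ‖x‖ ^ (2 - (d : ℝ)) = 1 := by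
    rw [← mul_rpow (by positivity) hn.le, inv_mul_cancel₀ hn.ne', one_rpow]
  calc ‖iteratedFDeriv ℝ k (newtonKernel d 0) x‖
      = (‖x‖⁻¹ ^ (2 - (d : ℝ)) * ‖iteratedFDeriv ℝ k (newtonKernel d 0) x‖) *
          ‖x‖ ^ (2 - (d : ℝ)) := by
        rw [mul_right_comm, h3, one_mul]
    _ ≤ (max C 0 * ‖x‖⁻¹ ^ k) * ‖x‖ ^ (2 - (d : ℝ)) := by
        exact mul_le_mul_of_nonneg_right (h1.trans (by gcongr)) (by positivity)
    _ = max C 0 * ‖x‖ ^ (2 - (d : ℝ) - k) := by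
        rw [rpow_sub hn (2 - (d : ℝ)), rpow_natCast, inv_pow]
        ring

theorem exists_norm_iteratedFDeriv_newtonKernel_le_of_lt {d : ℕ} (hd : 3 ≤ d) (k : ℕ) {δ : ℝ}
    (hδ : 0 < δ) : ∃ B : ℝ, ∀ x : Ed d, δ < ‖x‖ →
      ‖iteratedFDeriv ℝ k (newtonKernel d 0) x‖ ≤ B := by
  obtain ⟨C, hC0, hC⟩ := exists_norm_iteratedFDeriv_newtonKernel_le d k
  have hd' : (3 : ℝ) ≤ d := by exact_mod_cast hd
  refine ⟨C * δ ^ (2 - (d : ℝ) - k), fun x hx => (hC x ?_).trans ?_⟩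
  · exact norm_pos_iff.1 (hδ.trans hx)
  · have : 2 - (d : ℝ) - k ≤ 0 := by linarith [k.cast_nonneg (α := ℝ)]
    exact mul_le_mul_of_nonneg_left (rpow_le_rpow_of_nonpos hδ hx.le this) hC0
/-! ### Potentials of densities vanishing near a point -/

theorem aestronglyMeasurable_of_continuousOn_compl_zero {d : ℕ} [NeZero d] {F : Type*}
    [NormedAddCommGroup F] {G : Ed d → F} (hG : ContinuousOn G {0}ᶜ) :
    AEStronglyMeasurable G := by
  have := hG.aestronglyMeasurable (μ := volume) (measurableSet_singleton 0).compl
  rwa [restrict_compl_singleton] at this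

theorem aestronglyMeasurable_smul_comp_sub {d : ℕ} [NeZero d] {F : Type*}
    [NormedAddCommGroup F] [NormedSpace ℝ F] {G : Ed d → F} (hG : ContinuousOn G {0}ᶜ)
    {h : Ed d → ℝ} (hh : AEStronglyMeasurable h) (x : Ed d) :
    AEStronglyMeasurable fun y => h y • G (x - y) :=
  hh.smul ((aestronglyMeasurable_of_continuousOn_compl_zero hG).comp_quasiMeasurePreserving
    (quasiMeasurePreserving_sub_left volume x))

theorem integrable_smul_comp_sub_of_vanish {d : ℕ} [NeZero d] {F : Type*}
    [NormedAddCommGroup F] [NormedSpace ℝ F] {G : Ed d → F} (hG : ContinuousOn G {0}ᶜ)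
    {h : Ed d → ℝ} (hh : Integrable h) {x₀ x : Ed d} {δ B : ℝ}
    (hB : ∀ z, δ < ‖z‖ → ‖G z‖ ≤ B) (h0 : ∀ y ∈ ball x₀ (2 * δ), h y = 0) (hx : x ∈ ball x₀ δ) :
    Integrable fun y => h y • G (x - y) := by
  refine (hh.norm.mul_const B).mono' (aestronglyMeasurable_smul_comp_sub hG hh.1 x)
    (Eventually.of_forall fun y => ?_)
  by_cases hy : y ∈ ball x₀ (2 * δ)
  · simp [h0 y hy]
  · rw [norm_smul]
    refine mul_le_mul_of_nonneg_left (hB _ ?_) (norm_nonneg _)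
    rw [mem_ball, dist_eq_norm] at hy hx
    have := norm_sub_le_norm_sub_add_norm_sub y x x₀
    rw [norm_sub_rev]
    linarith

theorem hasFDerivAt_integral_smul_comp_sub_of_vanish {d : ℕ} [NeZero d] {F : Type*}
    [NormedAddCommGroup F] [NormedSpace ℝ F] {G : Ed d → F} (hG : ContDiffOn ℝ 1 G {0}ᶜ)
    {h : Ed d → ℝ} (hh : Integrable h) {x₀ x : Ed d} {δ B B' : ℝ} (hδ : 0 < δ)
    (hB : ∀ z, δ < ‖z‖ → ‖G z‖ ≤ B) (hB' : ∀ z, δ < ‖z‖ → ‖fderiv ℝ G z‖ ≤ B')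
    (h0 : ∀ y ∈ ball x₀ (2 * δ), h y = 0) (hx : x ∈ ball x₀ δ) :
    HasFDerivAt (fun x => ∫ y, h y • G (x - y)) (∫ y, h y • fderiv ℝ G (x - y)) x := by
  have hG' : ContinuousOn (fderiv ℝ G) {0}ᶜ :=
    hG.continuousOn_fderiv_of_isOpen isOpen_compl_singleton le_rfl
  have far : ∀ {x y : Ed d}, x ∈ ball x₀ δ → y ∉ ball x₀ (2 * δ) → δ < ‖x - y‖ := by
    intro x y hx hy
    rw [mem_ball, dist_eq_norm] at hy hx
    have := norm_sub_le_norm_sub_add_norm_sub y x x₀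
    rw [norm_sub_rev]
    linarith
  refine hasFDerivAt_integral_of_dominated_of_fderiv_le (F' := fun x y => h y • fderiv ℝ G (x - y))
    (bound := fun y => ‖h y‖ * B') (isOpen_ball.mem_nhds hx)
    (Eventually.of_forall fun x => aestronglyMeasurable_smul_comp_sub hG.continuousOn hh.1 x)
    (integrable_smul_comp_sub_of_vanish hG.continuousOn hh hB h0 hx)
    (aestronglyMeasurable_smul_comp_sub hG' hh.1 x)
    (Eventually.of_forall fun y z hz => ?_) (hh.norm.mul_const B')
    (Eventually.of_forall fun y z hz => ?_)
  · by_cases hy : y ∈ ball x₀ (2 * δ)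
    · simp [h0 y hy]
    · rw [norm_smul]
      exact mul_le_mul_of_nonneg_left (hB' _ (far hz hy)) (norm_nonneg _)
  · by_cases hy : y ∈ ball x₀ (2 * δ)
    · simpa [h0 y hy] using hasFDerivAt_const (0 : F) z
    · have hne : z - y ∈ ({0}ᶜ : Set (Ed d)) := by
        have := hδ.trans (far hz hy)
        simpa using norm_pos_iff.1 this
      have := ((hG.differentiableOn one_ne_zero).differentiableAt
        (isOpen_compl_singleton.mem_nhds hne)).hasFDerivAt
      exact ((this.comp z ((hasFDerivAt_id z).sub_const y)).congr_fderiv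
        (ContinuousLinearMap.comp_id _)).const_smul (h y)

set_option maxSynthPendingDepth 3 in
theorem hasLaplacianAt_newtonPotential_of_vanish {d : ℕ} (hd : 3 ≤ d) {h : Ed d → ℝ}
    (hh : Integrable h) {x₀ : Ed d} {δ : ℝ} (hδ : 0 < δ) (h0 : ∀ y ∈ ball x₀ (2 * δ), h y = 0) :
    HasLaplacianAt (fun x => ∫ y, newtonKernel d 0 (x - y) * h y) 0 x₀ := by
  have : NeZero d := ⟨by omega⟩
  have c0 : ContDiffOn ℝ ⊤ (newtonKernel d 0) {0}ᶜ := fun z hz =>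
    (contDiffAt_newtonKernel (zero_add_norm_sq_pos hz)).contDiffWithinAt
  have c1 : ContDiffOn ℝ ⊤ (fderiv ℝ (newtonKernel d 0)) {0}ᶜ := fun z hz =>
    ((contDiffAt_newtonKernel (n := ⊤) (zero_add_norm_sq_pos hz)).fderiv_right
      (by simp)).contDiffWithinAt
  have c2 : ContinuousOn (fderiv ℝ (fderiv ℝ (newtonKernel d 0))) {0}ᶜ :=
    c1.continuousOn_fderiv_of_isOpen isOpen_compl_singleton (by simp)
  obtain ⟨B0, hB0⟩ := exists_norm_iteratedFDeriv_newtonKernel_le_of_lt hd 0 hδ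
  obtain ⟨B1, hB1⟩ := exists_norm_iteratedFDeriv_newtonKernel_le_of_lt hd 1 hδ
  obtain ⟨B2, hB2⟩ := exists_norm_iteratedFDeriv_newtonKernel_le_of_lt hd 2 hδ
  simp only [norm_iteratedFDeriv_zero] at hB0
  simp only [norm_iteratedFDeriv_one] at hB1
  simp only [← norm_iteratedFDeriv_fderiv (n := 1), norm_iteratedFDeriv_one] at hB2
  have hx₀ : x₀ ∈ ball x₀ δ := mem_ball_self hδ
  refine ⟨fun x => ∫ y, h y • fderiv ℝ (newtonKernel d 0) (x - y), _, ?_,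
    hasFDerivAt_integral_smul_comp_sub_of_vanish (c1.of_le le_top) hh hδ hB1 hB2 h0 hx₀, ?_⟩
  · filter_upwards [isOpen_ball.mem_nhds hx₀] with x hx
    simpa only [smul_eq_mul, mul_comm] using
      hasFDerivAt_integral_smul_comp_sub_of_vanish (c0.of_le le_top) hh hδ hB0 hB1 h0 hx
  · have h_int : Integrable fun y => h y • fderiv ℝ (fderiv ℝ (newtonKernel d 0)) (x₀ - y) :=
      integrable_smul_comp_sub_of_vanish c2 hh hB2 h0 hx₀
    have h1 : ∀ v : Ed d, (∫ y, h y • fderiv ℝ (fderiv ℝ (newtonKernel d 0)) (x₀ - y)) v v =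
        ∫ y, h y * fderiv ℝ (fderiv ℝ (newtonKernel d 0)) (x₀ - y) v v := fun v => by
      rw [ContinuousLinearMap.integral_apply h_int, ContinuousLinearMap.integral_apply
        (h_int.apply_continuousLinearMap v)]
      simp
    simp only [h1]
    rw [← integral_finsetSum _ fun i _ => by
      have := (h_int.apply_continuousLinearMap (EuclideanSpace.single i
        1)).apply_continuousLinearMap
        (EuclideanSpace.single i 1)
      simpa using this]
    refine integral_eq_zero_of_ae (Eventually.of_forall fun y => ?_)
    by_cases hy : y ∈ ball x₀ (2 * δ)
    · simp [h0 y hy]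
    · have hne : x₀ - y ≠ 0 := by
        intro e
        rw [sub_eq_zero.1 e] at hy
        exact hy (mem_ball_self (by positivity))
      have := (hasLaplacianAt_newtonKernel (zero_add_norm_sq_pos hne)).lapScalar_eq
      simp only [lapScalar, iteratedFDeriv_two_apply, mul_zero, zero_mul] at this
      simpa [← Finset.mul_sum] using Or.inr this

/-! ### Multipoles -/

theorem norm_apply_neg_mul_le {d k : ℕ} (m : (Ed d) [×k]→L[ℝ] ℝ) (y : Ed d) (r : ℝ) :
    ‖m (fun _ => -y) * r‖ ≤ ‖m‖ * (‖y‖ ^ k * ‖r‖) := by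
  rw [norm_mul, ← mul_assoc]
  refine mul_le_mul_of_nonneg_right ((m.le_opNorm _).trans_eq ?_) (norm_nonneg _)
  simp

theorem integrable_apply_neg_mul {d k : ℕ} {F : Ed d → ℝ} (hF : AEStronglyMeasurable F)
    (hk : Integrable fun y => ‖y‖ ^ k * ‖F y‖) (m : (Ed d) [×k]→L[ℝ] ℝ) :
    Integrable fun y => m (fun _ => -y) * F y :=
  (hk.const_mul ‖m‖).mono' (by
    refine AEStronglyMeasurable.mul (Continuous.aestronglyMeasurable ?_) hF
    exact m.cont.comp (by fun_prop)) (Eventually.of_forall fun y => norm_apply_neg_mul_le m y _)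

/-- The linear form sending a multilinear form to its `k`-th moment against `F`. -/
def momentForm {d k : ℕ} {F : Ed d → ℝ} (hF : AEStronglyMeasurable F)
    (hk : Integrable fun y => ‖y‖ ^ k * ‖F y‖) : ((Ed d) [×k]→L[ℝ] ℝ) →L[ℝ] ℝ :=
  LinearMap.mkContinuous
    { toFun := fun m => ∫ y, m (fun _ => -y) * F y
      map_add' := fun m m' => by
        simp only [add_apply, add_mul]
        exact integral_add (integrable_apply_neg_mul hF hk m) (integrable_apply_neg_mul hF hk m')
      map_smul' := fun c m => by
        simp only [smul_apply, smul_eq_mul, mul_assoc, integral_const_mul, RingHom.id_apply] }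
    (∫ y, ‖y‖ ^ k * ‖F y‖) fun m => by
      refine (norm_integral_le_of_norm_le (hk.const_mul ‖m‖)
        (Eventually.of_forall fun y => norm_apply_neg_mul_le m y _)).trans_eq ?_
      rw [integral_const_mul, mul_comm]

theorem hasLaplacianAt_multipole {d k : ℕ} {F : Ed d → ℝ} (hF : AEStronglyMeasurable F)
    (hk : Integrable fun y => ‖y‖ ^ k * ‖F y‖) {x : Ed d} (hx : x ≠ 0) :
    HasLaplacianAt (fun x => ∫ y, iteratedFDeriv ℝ k (newtonKernel d 0) x (fun _ => -y) * F y)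
      0 x := by
  have hc := (contDiffAt_iteratedFDeriv_newtonKernel hx k).of_le (m := 2) le_top
  have h1 := hc.laplacian_CLM_comp_left (l := momentForm hF hk)
  rw [Function.comp_apply, laplacian_iteratedFDeriv_newtonKernel k hx, map_zero] at h1
  have h2 := ((momentForm hF hk).contDiff.contDiffAt.comp x hc).hasLaplacianAt
  rw [h1] at h2
  exact h2
/-! ### The Newtonian kernel with its multipole expansion removed -/

/-- The Newtonian kernel minus its Taylor polynomial of degree `J` in the second variable. -/
def multipoleKernel (d J : ℕ) (x y : Ed d) : ℝ :=
  newtonKernel d 0 (x - y) - ∑ k ∈ Finset.range (J + 1),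
    (k.factorial : ℝ)⁻¹ * iteratedFDeriv ℝ k (newtonKernel d 0) x (fun _ => -y)

theorem exists_abs_multipoleKernel_le_of_two_mul_le (d J : ℕ) (hd : 3 ≤ d) :
    ∃ A : ℝ, 0 ≤ A ∧ ∀ x y : Ed d, x ≠ 0 → 2 * ‖y‖ ≤ ‖x‖ →
      |multipoleKernel d J x y| ≤ A * (‖x‖ ^ (2 - (d : ℝ) - (J + 1 : ℕ)) * ‖y‖ ^ (J + 1)) := by
  obtain ⟨C, hC0, hC⟩ := exists_norm_iteratedFDeriv_newtonKernel_le d (J + 1)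
  have hd' : (3 : ℝ) ≤ d := by exact_mod_cast hd
  set p : ℝ := 2 - (d : ℝ) - (J + 1 : ℕ) with hp
  have hp0 : p ≤ 0 := by
    have : (0 : ℝ) ≤ (J + 1 : ℕ) := Nat.cast_nonneg _
    linarith
  refine ⟨C * 2⁻¹ ^ p, by positivity, fun x y hx hxy => ?_⟩
  have hn : 0 < ‖x‖ := norm_pos_iff.2 hx
  have hlow : ∀ t ∈ Set.Icc (0 : ℝ) 1, ‖x‖ * 2⁻¹ ≤ ‖x + t • -y‖ := fun t ht => by
    have h1 : ‖t • -y‖ ≤ ‖y‖ := by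
      rw [norm_smul, norm_neg, Real.norm_of_nonneg ht.1]
      exact mul_le_of_le_one_left (norm_nonneg _) ht.2
    have h2 := norm_sub_norm_le x (-(t • -y))
    rw [norm_neg, sub_neg_eq_add] at h2
    linarith
  have hne : ∀ t ∈ Set.Icc (0 : ℝ) 1, x + t • -y ≠ 0 := fun t ht =>
    norm_pos_iff.1 ((by positivity : 0 < ‖x‖ * 2⁻¹).trans_le (hlow t ht))
  have ht := map_add_eq_sum_add_integral_iteratedFDeriv (n := J) (f := newtonKernel d 0)
    (x := x) (y := -y) fun t ht => contDiffAt_newtonKernel (zero_add_norm_sq_pos (hne t ht))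
  have hK : multipoleKernel d J x y = (J.factorial : ℝ)⁻¹ • ∫ t in (0 : ℝ)..1, (1 - t) ^ J •
      iteratedFDeriv ℝ (J + 1) (newtonKernel d 0) (x + t • -y) (fun _ => -y) := by
    rw [multipoleKernel, sub_eq_add_neg x y, ht]
    simp only [smul_eq_mul]
    ring
  have h_int : ‖∫ t in (0 : ℝ)..1, (1 - t) ^ J •
      iteratedFDeriv ℝ (J + 1) (newtonKernel d 0) (x + t • -y) (fun _ => -y)‖ ≤
        (C * 2⁻¹ ^ p * (‖x‖ ^ p * ‖y‖ ^ (J + 1))) * |(1 : ℝ) - 0| := by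
    refine intervalIntegral.norm_integral_le_of_norm_le_const fun t ht => ?_
    rw [Set.uIoc_of_le zero_le_one] at ht
    have ht' : t ∈ Set.Icc (0 : ℝ) 1 := ⟨ht.1.le, ht.2⟩
    rw [norm_smul, norm_pow, Real.norm_of_nonneg (by linarith [ht.2])]
    have h1 : (1 - t) ^ J ≤ 1 := pow_le_one₀ (by linarith [ht.2]) (by linarith [ht.1])
    refine (mul_le_of_le_one_left (norm_nonneg _) h1).trans
      ((ContinuousMultilinearMap.le_opNorm _ _).trans ?_)
    rw [Finset.prod_const, Finset.card_univ, Fintype.card_fin, norm_neg, ← mul_assoc]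
    refine mul_le_mul_of_nonneg_right ((hC _ (hne t ht')).trans ?_) (by positivity)
    rw [mul_assoc, mul_comm (2⁻¹ ^ p), ← mul_rpow hn.le (by norm_num)]
    exact mul_le_mul_of_nonneg_left
      (rpow_le_rpow_of_nonpos (by positivity) (hlow t ht') hp0) hC0
  rw [sub_zero, abs_one, mul_one] at h_int
  rw [hK, ← Real.norm_eq_abs, norm_smul]
  refine (mul_le_of_le_one_left (norm_nonneg _) ?_).trans h_int
  rw [norm_inv, Real.norm_natCast]
  exact inv_le_one_of_one_le₀ (by exact_mod_cast Nat.one_le_iff_ne_zero.2 J.factorial_ne_zero)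

/-- The size of the multipole kernel away from its diagonal. -/
def multipoleWeight (d J : ℕ) (x y : Ed d) : ℝ :=
  if ‖y‖ ≤ ‖x‖ then ‖x‖ ^ (2 - (d : ℝ) - (J + 1 : ℕ)) * ‖y‖ ^ (J + 1)
  else ‖x‖ ^ (2 - (d : ℝ) - J) * ‖y‖ ^ J

theorem rpow_mul_pow_le_multipoleWeight {d J k : ℕ} (hk : k ≤ J) {x y : Ed d} (hx : x ≠ 0)
    (hxy : ‖x‖ ≤ 2 * ‖y‖) :
    ‖x‖ ^ (2 - (d : ℝ) - k) * ‖y‖ ^ k ≤ 2 ^ (J + 1) * multipoleWeight d J x y := by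
  have hn : 0 < ‖x‖ := norm_pos_iff.2 hx
  have e : ∀ m : ℕ, ‖x‖ ^ (2 - (d : ℝ) - m) * ‖y‖ ^ m =
      ‖x‖ ^ (2 - (d : ℝ)) * (‖y‖ / ‖x‖) ^ m := fun m => by
    rw [rpow_sub hn (2 - (d : ℝ)), rpow_natCast, div_pow]
    ring
  have hq : 0 ≤ ‖x‖ ^ (2 - (d : ℝ)) := by positivity
  rw [multipoleWeight]
  split_ifs with h
  · rw [e, e, mul_left_comm]
    refine mul_le_mul_of_nonneg_left ?_ hq
    rw [← mul_pow]
    have h1 : 1 ≤ 2 * (‖y‖ / ‖x‖) := by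
      rw [← mul_div_assoc, one_le_div hn]
      exact hxy
    refine le_trans ?_ (pow_le_pow_right₀ h1 (by omega : k ≤ J + 1))
    exact pow_le_pow_left₀ (by positivity) (by linarith [div_nonneg (norm_nonneg y) hn.le]) _
  · rw [e, e, mul_left_comm]
    refine mul_le_mul_of_nonneg_left ?_ hq
    have h1 : 1 ≤ ‖y‖ / ‖x‖ := by
      rw [one_le_div hn]
      exact (not_le.1 h).le
    refine (pow_le_pow_right₀ h1 hk).trans (le_mul_of_one_le_left (by positivity) ?_)
    exact one_le_pow₀ one_le_two

theorem multipoleWeight_nonneg (d J : ℕ) (x y : Ed d) : 0 ≤ multipoleWeight d J x y := by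
  rw [multipoleWeight]
  split_ifs <;> positivity

theorem exists_abs_multipoleKernel_le (d J : ℕ) (hd : 3 ≤ d) :
    ∃ A : ℝ, 0 ≤ A ∧ ∀ x y : Ed d, x ≠ 0 → |multipoleKernel d J x y| ≤
      (if ‖x‖ ≤ 2 * ‖y‖ ∧ ‖y‖ ≤ 2 * ‖x‖ then newtonKernel d 0 (x - y) else 0) +
        A * multipoleWeight d J x y := by
  obtain ⟨A, hA0, hA⟩ := exists_abs_multipoleKernel_le_of_two_mul_le d J hd
  choose C hC0 hC using exists_norm_iteratedFDeriv_newtonKernel_le d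
  have hd' : (3 : ℝ) ≤ d := by exact_mod_cast hd
  have hS0 : 0 ≤ ∑ k ∈ Finset.range (J + 1), C k := Finset.sum_nonneg fun k _ => hC0 k
  have hN0 : ∀ z : Ed d, 0 ≤ newtonKernel d 0 z := fun z => by
    rw [newtonKernel_zero]
    positivity
  refine ⟨A + (∑ k ∈ Finset.range (J + 1), C k + 1) * 2 ^ (J + 1), by positivity,
    fun x y hx => ?_⟩
  have hn : 0 < ‖x‖ := norm_pos_iff.2 hx
  have hW := multipoleWeight_nonneg d J x y
  rcases le_or_gt (2 * ‖y‖) ‖x‖ with hxy | hxy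
  · have h1 := hA x y hx hxy
    have h2 : ‖x‖ ^ (2 - (d : ℝ) - (J + 1 : ℕ)) * ‖y‖ ^ (J + 1) = multipoleWeight d J x y := by
      rw [multipoleWeight, if_pos (by linarith [norm_nonneg y])]
    rw [h2] at h1
    have h3 : 0 ≤ if ‖x‖ ≤ 2 * ‖y‖ ∧ ‖y‖ ≤ 2 * ‖x‖ then newtonKernel d 0 (x - y) else 0 := by
      split_ifs
      exacts [hN0 _, le_rfl]
    have h4 : 0 ≤ (∑ k ∈ Finset.range (J + 1), C k + 1) * 2 ^ (J + 1) *
      multipoleWeight d J x y := by positivity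
    rw [add_mul]
    linarith
  · have hsum : |∑ k ∈ Finset.range (J + 1), (k.factorial : ℝ)⁻¹ *
        iteratedFDeriv ℝ k (newtonKernel d 0) x (fun _ => -y)| ≤
          (∑ k ∈ Finset.range (J + 1), C k) * (2 ^ (J + 1) * multipoleWeight d J x y) := by
      rw [Finset.sum_mul]
      refine (Finset.abs_sum_le_sum_abs _ _).trans (Finset.sum_le_sum fun k hk => ?_)
      have hk' : k ≤ J := by
        rw [Finset.mem_range] at hk
        omega
      rw [abs_mul, abs_inv, Nat.abs_cast]
      refine (mul_le_of_le_one_left (abs_nonneg _) (inv_le_one_of_one_le₀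
        (by exact_mod_cast Nat.one_le_iff_ne_zero.2 k.factorial_ne_zero))).trans ?_
      rw [← Real.norm_eq_abs]
      refine (ContinuousMultilinearMap.le_opNorm _ _).trans ?_
      rw [Finset.prod_const, Finset.card_univ, Fintype.card_fin, norm_neg]
      refine (mul_le_mul_of_nonneg_right (hC k x hx) (by positivity)).trans ?_
      rw [mul_assoc]
      exact mul_le_mul_of_nonneg_left (rpow_mul_pow_le_multipoleWeight hk' hx hxy.le) (hC0 k)
    have hnear : newtonKernel d 0 (x - y) ≤
        (if ‖x‖ ≤ 2 * ‖y‖ ∧ ‖y‖ ≤ 2 * ‖x‖ then newtonKernel d 0 (x - y) else 0) +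
          2 ^ (J + 1) * multipoleWeight d J x y := by
      split_ifs with h
      · exact le_add_of_nonneg_right (by positivity)
      · have h1 : 2 * ‖x‖ < ‖y‖ := by
          by_contra h2
          exact h ⟨hxy.le, not_lt.1 h2⟩
        have h2 : ‖x‖ ≤ ‖x - y‖ := by
          have := norm_sub_norm_le y x
          rw [norm_sub_rev] at this
          linarith
        have h3 := rpow_mul_pow_le_multipoleWeight (d := d) (Nat.zero_le J) hx hxy.le
        rw [Nat.cast_zero, sub_zero, pow_zero, mul_one] at h3
        rw [zero_add, newtonKernel_zero]
        exact (rpow_le_rpow_of_nonpos hn h2 (by linarith)).trans h3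
    have h4 : 0 ≤ A * multipoleWeight d J x y := by positivity
    rw [multipoleKernel]
    refine (abs_sub _ _).trans ?_
    rw [abs_of_nonneg (hN0 _)]
    linarith
/-! ### Dyadic estimates -/

/-- The dyadic shell of inner radius `t`. -/
def dyadicShell (d : ℕ) (t : ℝ) : Set (Ed d) := {y | t < ‖y‖ ∧ ‖y‖ ≤ 2 * t}

theorem volume_dyadicShell_le (d : ℕ) {t : ℝ} (ht : 0 < t) :
    volume (dyadicShell d t) ≤ ENNReal.ofReal ((2 * t) ^ d * volume.real (ball (0 : Ed d) 1)) := by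
  have h1 : dyadicShell d t ⊆ closedBall 0 (2 * t) := fun y hy => by simpa using hy.2
  refine (measure_mono h1).trans_eq ?_
  rw [Measure.addHaar_closedBall _ _ (by positivity), finrank_euclideanSpace_fin,
    ENNReal.ofReal_mul (by positivity), ofReal_measureReal measure_ball_lt_top.ne]

theorem tsum_ofReal_mul_geometric {a q : ℝ} (ha : 0 ≤ a) (hq0 : 0 ≤ q) (hq1 : q < 1) :
    ∑' n : ℕ, ENNReal.ofReal (a * q ^ n) = ENNReal.ofReal (a / (1 - q)) := by
  rw [← ENNReal.ofReal_tsum_of_nonneg (fun n => by positivity)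
    ((summable_geometric_of_lt_one hq0 hq1).mul_left a), tsum_mul_left,
    tsum_geometric_of_lt_one hq0 hq1, div_eq_mul_inv]

theorem setLIntegral_lt_norm_le_of_dyadicShell {d : ℕ} {h : Ed d → ℝ≥0∞} {C σ : ℝ} (hC : 0 ≤ C)
    (hσ : σ < 0)
    (H : ∀ t, 0 < t → ∫⁻ y in dyadicShell d t, h y ≤ ENNReal.ofReal (C * t ^ σ)) {r : ℝ}
    (hr : 0 < r) :
    ∫⁻ y in {y | r < ‖y‖}, h y ≤ ENNReal.ofReal (C / (1 - 2 ^ σ) * r ^ σ) := by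
  have hcov : {y : Ed d | r < ‖y‖} ⊆ ⋃ n : ℕ, dyadicShell d (2 ^ n * r) := fun y hy => by
    have hy : r < ‖y‖ := hy
    obtain ⟨n, hn⟩ := exists_mem_Ioc_zpow (div_pos (hr.trans hy) hr) one_lt_two
    have h0 : 0 ≤ n := by
      have h1 : (2 : ℝ) ^ (0 : ℤ) < 2 ^ (n + 1) := by
        rw [zpow_zero]
        exact ((one_lt_div hr).2 hy).trans_le hn.2
      have := (zpow_lt_zpow_iff_right₀ one_lt_two).1 h1
      omega
    lift n to ℕ using h0
    refine Set.mem_iUnion.2 ⟨n, ?_, ?_⟩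
    · have := (lt_div_iff₀ hr).1 hn.1
      simpa using this
    · have := (div_le_iff₀ hr).1 hn.2
      rw [zpow_add_one₀ two_ne_zero] at this
      simp only [zpow_natCast] at this
      linarith
  calc ∫⁻ y in {y | r < ‖y‖}, h y ≤ ∑' n : ℕ, ∫⁻ y in dyadicShell d (2 ^ n * r), h y :=
        (lintegral_mono_set hcov).trans (lintegral_iUnion_le _ _)
    _ ≤ ∑' n : ℕ, ENNReal.ofReal (C * r ^ σ * (2 ^ σ) ^ n) := by
        refine ENNReal.tsum_le_tsum fun n => (H _ (by positivity)).trans_eq ?_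
        rw [mul_rpow (by positivity) hr.le, ← rpow_natCast 2 n, ← rpow_mul (by norm_num),
          mul_comm (n : ℝ), rpow_mul (by norm_num), rpow_natCast]
        ring_nf
    _ = ENNReal.ofReal (C / (1 - 2 ^ σ) * r ^ σ) := by
        rw [tsum_ofReal_mul_geometric (by positivity) (by positivity)
          (rpow_lt_one_of_one_lt_of_neg one_lt_two hσ)]
        ring_nf

theorem setLIntegral_norm_le_le_of_dyadicShell {d : ℕ} [NeZero d] {h : Ed d → ℝ≥0∞} {C σ : ℝ}
    (hC : 0 ≤ C) (hσ : 0 < σ)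
    (H : ∀ t, 0 < t → ∫⁻ y in dyadicShell d t, h y ≤ ENNReal.ofReal (C * t ^ σ)) {r : ℝ}
    (hr : 0 < r) :
    ∫⁻ y in {y | ‖y‖ ≤ r}, h y ≤ ENNReal.ofReal (C / (2 ^ σ - 1) * r ^ σ) := by
  have hcov : {y : Ed d | ‖y‖ ≤ r} ⊆ {0} ∪ ⋃ n : ℕ, dyadicShell d (2⁻¹ ^ (n + 1) * r) :=
    fun y hy => by
    have hy : ‖y‖ ≤ r := hy
    rcases eq_or_ne y 0 with rfl | h0
    · exact Or.inl rfl
    obtain ⟨n, hn⟩ := exists_mem_Ioc_zpow (div_pos (norm_pos_iff.2 h0) hr) one_lt_two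
    have h0 : n < 0 := by
      have h1 : (2 : ℝ) ^ n < 2 ^ (0 : ℤ) := by
        rw [zpow_zero]
        exact hn.1.trans_le ((div_le_one hr).2 hy)
      exact (zpow_lt_zpow_iff_right₀ one_lt_two).1 h1
    obtain ⟨m, rfl⟩ : ∃ m : ℕ, n = -((m + 1 : ℕ) : ℤ) := ⟨(-n - 1).toNat, by omega⟩
    refine Or.inr (Set.mem_iUnion.2 ⟨m, ?_, ?_⟩)
    · have := (lt_div_iff₀ hr).1 hn.1
      rwa [zpow_neg, zpow_natCast, ← inv_pow] at this
    · have := (div_le_iff₀ hr).1 hn.2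
      rw [zpow_add_one₀ two_ne_zero, zpow_neg, zpow_natCast, ← inv_pow] at this
      linarith
  calc ∫⁻ y in {y | ‖y‖ ≤ r}, h y
      ≤ 0 + ∑' n : ℕ, ∫⁻ y in dyadicShell d (2⁻¹ ^ (n + 1) * r), h y := by
        refine (lintegral_mono_set hcov).trans ((lintegral_union_le _ _ _).trans
          (add_le_add (le_of_eq ?_) (lintegral_iUnion_le _ _)))
        rw [Measure.restrict_singleton, measure_singleton, zero_smul, lintegral_zero_measure]
    _ ≤ ∑' n : ℕ, ENNReal.ofReal (C * r ^ σ * 2⁻¹ ^ σ * (2⁻¹ ^ σ) ^ n) := by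
        rw [zero_add]
        refine ENNReal.tsum_le_tsum fun n => (H _ (by positivity)).trans_eq ?_
        rw [mul_rpow (by positivity) hr.le, ← rpow_natCast 2⁻¹ (n + 1),
          ← rpow_mul (by norm_num), mul_comm ((n + 1 : ℕ) : ℝ), rpow_mul (by norm_num),
          rpow_natCast, pow_succ]
        ring_nf
    _ = ENNReal.ofReal (C / (2 ^ σ - 1) * r ^ σ) := by
        rw [tsum_ofReal_mul_geometric (by positivity) (by positivity)
          (rpow_lt_one (by norm_num) (by norm_num) hσ), inv_rpow (by norm_num)]
        have h2 : (1 : ℝ) < 2 ^ σ := one_lt_rpow one_lt_two hσ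
        congr 1
        have : (2 : ℝ) ^ σ - 1 ≠ 0 := by linarith
        field_simp

theorem setLIntegral_dyadicShell_norm_rpow_le (d : ℕ) {p : ℝ} (hp : p ≤ 0) {t : ℝ} (ht : 0 < t) :
    ∫⁻ y in dyadicShell d t, ENNReal.ofReal (‖y‖ ^ p) ≤
      ENNReal.ofReal (2 ^ d * volume.real (ball (0 : Ed d) 1) * t ^ (p + d)) := by
  calc ∫⁻ y in dyadicShell d t, ENNReal.ofReal (‖y‖ ^ p)
      ≤ ∫⁻ y in dyadicShell d t, ENNReal.ofReal (t ^ p) :=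
        setLIntegral_mono measurable_const fun y hy =>
          ENNReal.ofReal_le_ofReal (rpow_le_rpow_of_nonpos ht hy.1.le hp)
    _ ≤ ENNReal.ofReal (t ^ p) *
          ENNReal.ofReal ((2 * t) ^ d * volume.real (ball (0 : Ed d) 1)) := by
        rw [setLIntegral_const]
        gcongr
        exact volume_dyadicShell_le d ht
    _ = _ := by
        rw [← ENNReal.ofReal_mul (by positivity), rpow_add ht, rpow_natCast]
        ring_nf

theorem setLIntegral_dyadicShell_moment_le {d : ℕ} {g : Ed d → ℝ≥0∞} (hg : Measurable g) {γ : ℝ}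
    (H : ∀ R, 0 < R → ∫⁻ y in {y | R < ‖y‖}, (‖y‖ₑ * g y) ^ 2 ≤
      ENNReal.ofReal (R ^ ((d : ℝ) - 2 * γ - 2))) (s : ℕ) {t : ℝ} (ht : 0 < t) :
    ∫⁻ y in dyadicShell d t, ‖y‖ₑ ^ s * g y ≤ ENNReal.ofReal
      (2 ^ s * (2 ^ d * volume.real (ball (0 : Ed d) 1)) ^ (2⁻¹ : ℝ) *
        t ^ (s + d - γ - 2 : ℝ)) := by
  set ω := volume.real (ball (0 : Ed d) 1) with hω
  have hω0 : 0 ≤ ω := measureReal_nonneg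
  have hmn : Measurable fun y : Ed d => ‖y‖ₑ * g y := measurable_enorm.mul hg
  have hpt : ∀ y ∈ dyadicShell d t, ‖y‖ₑ ^ s * g y ≤
      ENNReal.ofReal ((2 * t) ^ s * t⁻¹) * (‖y‖ₑ * g y) := fun y hy => by
    have hny : 0 < ‖y‖ := ht.trans hy.1
    rw [← mul_assoc]
    refine mul_le_mul_left ?_ _
    rw [← ofReal_norm, ← ENNReal.ofReal_pow (norm_nonneg _), ← ENNReal.ofReal_mul (by positivity)]
    refine ENNReal.ofReal_le_ofReal ?_
    have h1 : ‖y‖ ^ s ≤ (2 * t) ^ s := pow_le_pow_left₀ (norm_nonneg _) hy.2 _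
    have h2 : 1 ≤ t⁻¹ * ‖y‖ := by
      rw [inv_mul_eq_div, one_le_div ht]
      exact hy.1.le
    rw [mul_assoc]
    exact h1.trans (le_mul_of_one_le_right (by positivity) h2)
  have hcs : ∫⁻ y in dyadicShell d t, ‖y‖ₑ * g y ≤
      ENNReal.ofReal (t ^ ((d : ℝ) - 2 * γ - 2)) ^ (2⁻¹ : ℝ) *
        ENNReal.ofReal ((2 * t) ^ d * ω) ^ (2⁻¹ : ℝ) := by
    have := ENNReal.lintegral_mul_le_Lp_mul_Lq (volume.restrict (dyadicShell d t))
      Real.HolderConjugate.two_two hmn.aemeasurable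
      (measurable_const (a := (1 : ℝ≥0∞))).aemeasurable
    simp only [Pi.mul_apply, mul_one, one_div, one_pow, lintegral_const, one_mul,
      Measure.restrict_apply MeasurableSet.univ, Set.univ_inter, ENNReal.rpow_two] at this
    refine this.trans (mul_le_mul' (ENNReal.rpow_le_rpow ?_ (by norm_num))
      (ENNReal.rpow_le_rpow (volume_dyadicShell_le d ht) (by norm_num)))
    exact (lintegral_mono_set fun y hy => hy.1).trans (H t ht)
  calc ∫⁻ y in dyadicShell d t, ‖y‖ₑ ^ s * g y
      ≤ ENNReal.ofReal ((2 * t) ^ s * t⁻¹) * ∫⁻ y in dyadicShell d t, ‖y‖ₑ * g y := by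
        rw [← lintegral_const_mul _ hmn]
        exact setLIntegral_mono (hmn.const_mul _) hpt
    _ ≤ _ := mul_le_mul_right hcs _
    _ = _ := by
        rw [ENNReal.ofReal_rpow_of_nonneg (by positivity) (by norm_num),
          ENNReal.ofReal_rpow_of_nonneg (by positivity) (by norm_num),
          ← ENNReal.ofReal_mul (by positivity), ← ENNReal.ofReal_mul (by positivity)]
        congr 1
        have e1 : (2 * t) ^ d * ω = (2 ^ d * ω) * t ^ (d : ℝ) := by
          rw [rpow_natCast]
          ring
        have e2 : t ^ (s + d - γ - 2 : ℝ) =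
            t ^ s * t⁻¹ * (t ^ (((d : ℝ) - 2 * γ - 2) * 2⁻¹) * t ^ ((d : ℝ) * 2⁻¹)) := by
          rw [← rpow_natCast t s, ← rpow_neg_one t, ← rpow_add ht, ← rpow_add ht, ← rpow_add ht]
          ring_nf
        rw [e1, mul_rpow (by positivity) (by positivity), ← rpow_mul ht.le, ← rpow_mul ht.le, e2]
        ring
/-! ### The near part of the potential -/

theorem setLIntegral_norm_sub_le_newtonKernel_le {d : ℕ} (hd : 3 ≤ d) (x : Ed d) {ρ : ℝ}
    (hρ : 0 < ρ) : ∫⁻ y in {y | ‖x - y‖ ≤ ρ}, ENNReal.ofReal (newtonKernel d 0 (x - y)) ≤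
      ENNReal.ofReal (2 ^ d * volume.real (ball (0 : Ed d) 1) * ρ ^ 2) := by
  have : NeZero d := ⟨by omega⟩
  have hd' : (3 : ℝ) ≤ d := by exact_mod_cast hd
  have h1 := setLIntegral_norm_le_le_of_dyadicShell (d := d)
    (h := fun z => ENNReal.ofReal (newtonKernel d 0 z)) (σ := 2)
    (C := 2 ^ d * volume.real (ball (0 : Ed d) 1)) (by positivity) two_pos (fun t ht => by
      simpa only [newtonKernel_zero, sub_add_cancel] using
        setLIntegral_dyadicShell_norm_rpow_le d (p := 2 - (d : ℝ)) (by linarith) ht) hρ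
  have hm : ∀ z : Ed d, MeasurableSet {y : Ed d | ‖z - y‖ ≤ ρ} := fun z =>
    measurableSet_le (by fun_prop) measurable_const
  have h2 : ∫⁻ y in {y | ‖x - y‖ ≤ ρ}, ENNReal.ofReal (newtonKernel d 0 (x - y)) =
      ∫⁻ z in {z | ‖z‖ ≤ ρ}, ENNReal.ofReal (newtonKernel d 0 z) := by
    rw [← lintegral_indicator (hm x),
      ← lintegral_indicator (measurableSet_le measurable_norm measurable_const),
      ← lintegral_sub_left_eq_self _ x]
    refine lintegral_congr fun z => ?_
    simp [Set.indicator]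
  rw [h2]
  refine h1.trans (ENNReal.ofReal_le_ofReal ?_)
  rw [rpow_two, rpow_two]
  refine mul_le_mul_of_nonneg_right (div_le_self (by positivity) (by norm_num)) (by positivity)

/-- The Newtonian kernel restricted to pairs of points of comparable size. -/
def nearKernel (d : ℕ) (x y : Ed d) : ℝ≥0∞ :=
  if ‖x‖ ≤ 2 * ‖y‖ ∧ ‖y‖ ≤ 2 * ‖x‖ then ENNReal.ofReal (newtonKernel d 0 (x - y)) else 0

theorem nearKernel_comm {d : ℕ} (x y : Ed d) : nearKernel d x y = nearKernel d y x := by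
  simp only [nearKernel, newtonKernel_zero, norm_sub_rev x y, and_comm]

theorem measurable_nearKernel (d : ℕ) : Measurable (Function.uncurry (nearKernel d)) := by
  have h1 : MeasurableSet {p : Ed d × Ed d | ‖p.1‖ ≤ 2 * ‖p.2‖} :=
    measurableSet_le (by fun_prop) (by fun_prop)
  have h2 : MeasurableSet {p : Ed d × Ed d | ‖p.2‖ ≤ 2 * ‖p.1‖} :=
    measurableSet_le (by fun_prop) (by fun_prop)
  refine Measurable.ite (h1.inter h2) ?_ measurable_const
  exact ((measurable_newtonKernel d 0).comp (measurable_fst.sub measurable_snd)).ennreal_ofReal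

theorem lintegral_nearKernel_le {d : ℕ} (hd : 3 ≤ d) {x : Ed d} (hx : x ≠ 0) :
    ∫⁻ y, nearKernel d x y ≤
      ENNReal.ofReal (9 * (2 ^ d * volume.real (ball (0 : Ed d) 1))) * ‖x‖ₑ ^ 2 := by
  have hn : 0 < ‖x‖ := norm_pos_iff.2 hx
  have h1 := setLIntegral_norm_sub_le_newtonKernel_le hd x (by positivity : 0 < 3 * ‖x‖)
  rw [← lintegral_indicator (measurableSet_le (by fun_prop) measurable_const)] at h1
  refine (lintegral_mono fun y => ?_).trans (h1.trans_eq ?_)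
  · by_cases h : ‖x‖ ≤ 2 * ‖y‖ ∧ ‖y‖ ≤ 2 * ‖x‖
    · have : ‖x - y‖ ≤ 3 * ‖x‖ := (norm_sub_le _ _).trans (by linarith [h.2])
      rw [nearKernel, if_pos h, Set.indicator_of_mem (by exact this)]
    · rw [nearKernel, if_neg h]
      exact zero_le
  · rw [← ofReal_norm, ← ENNReal.ofReal_pow hn.le, ← ENNReal.ofReal_mul (by positivity)]
    ring_nf

theorem lintegral_mul_sq_le {α : Type*} [MeasurableSpace α] {μ : Measure α} {k g : α → ℝ≥0∞}
    (hk : Measurable k) (hg : Measurable g) :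
    (∫⁻ y, k y * g y ∂μ) ^ 2 ≤ (∫⁻ y, k y ∂μ) * ∫⁻ y, k y * g y ^ 2 ∂μ := by
  have h := ENNReal.lintegral_mul_le_Lp_mul_Lq (μ.withDensity k)
    Real.HolderConjugate.two_two hg.aemeasurable
    (measurable_const (a := (1 : ℝ≥0∞))).aemeasurable
  simp only [Pi.mul_apply, mul_one, one_div, one_pow, ENNReal.rpow_two] at h
  rw [lintegral_withDensity_eq_lintegral_mul _ hk hg,
    lintegral_withDensity_eq_lintegral_mul _ hk (hg.pow_const 2),
    lintegral_withDensity_eq_lintegral_mul _ hk measurable_const] at h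
  simp only [Pi.mul_apply, mul_one] at h
  refine (pow_le_pow_left₀ (zero_le) h 2).trans_eq ?_
  rw [mul_pow, ← ENNReal.rpow_two, ← ENNReal.rpow_two, ← ENNReal.rpow_mul, ← ENNReal.rpow_mul,
    inv_mul_cancel₀ two_ne_zero, ENNReal.rpow_one, ENNReal.rpow_one, mul_comm]

theorem setLIntegral_nearKernel_sq_le {d : ℕ} (hd : 3 ≤ d) {g : Ed d → ℝ≥0∞} (hg : Measurable g)
    {R : ℝ} (hR : 0 < R) :
    ∫⁻ x in {x | R ≤ ‖x‖}, (∫⁻ y, nearKernel d x y * g y) ^ 2 * (‖x‖ₑ ^ 2)⁻¹ ≤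
      ENNReal.ofReal (9 * (2 ^ d * volume.real (ball (0 : Ed d) 1))) ^ 2 *
        ∫⁻ y in {y | R / 4 < ‖y‖}, (‖y‖ₑ * g y) ^ 2 := by
  set c := ENNReal.ofReal (9 * (2 ^ d * volume.real (ball (0 : Ed d) 1))) with hc
  have hmk := measurable_nearKernel d
  have hmS : MeasurableSet {x : Ed d | R ≤ ‖x‖} := measurableSet_le measurable_const measurable_norm
  have hmT : MeasurableSet {x : Ed d | R / 4 < ‖x‖} :=
    measurableSet_lt measurable_const measurable_norm
  have hm2 : Measurable (Function.uncurry fun x y : Ed d => nearKernel d x y * g y ^ 2) :=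
    hmk.mul ((hg.comp measurable_snd).pow_const 2)
  have hpt : ∀ x ∈ {x : Ed d | R ≤ ‖x‖}, (∫⁻ y, nearKernel d x y * g y) ^ 2 * (‖x‖ₑ ^ 2)⁻¹ ≤
      c * ∫⁻ y, nearKernel d x y * g y ^ 2 := fun x hx => by
    have hx0 : x ≠ 0 := norm_pos_iff.1 (hR.trans_le hx)
    have h1 := (lintegral_mul_sq_le (μ := volume) (hmk.of_uncurry_left (x := x)) hg).trans
      (mul_le_mul_left (lintegral_nearKernel_le hd hx0) _)
    refine (mul_le_mul_left h1 _).trans_eq ?_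
    rw [mul_right_comm, mul_assoc c, ENNReal.mul_inv_cancel (by simpa using hx0) (by simp), mul_one]
  have hinner : ∀ y, ∫⁻ x in {x | R ≤ ‖x‖}, nearKernel d x y * g y ^ 2 ≤
      {y : Ed d | R / 4 < ‖y‖}.indicator (fun y => c * (‖y‖ₑ * g y) ^ 2) y := fun y => by
    by_cases hy : R / 4 < ‖y‖
    · have hy0 : y ≠ 0 := norm_pos_iff.1 ((by positivity : 0 < R / 4).trans hy)
      rw [Set.indicator_of_mem (by exact hy), lintegral_mul_const _
        (hmk.of_uncurry_right (y := y)), mul_pow, ← mul_assoc]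
      refine mul_le_mul_left ((setLIntegral_le_lintegral _ _).trans ?_) _
      simp only [fun x => nearKernel_comm x y]
      exact lintegral_nearKernel_le hd hy0
    · refine le_of_eq_of_le (setLIntegral_eq_zero hmS fun x hx => ?_) (zero_le)
      have hx : R ≤ ‖x‖ := hx
      have : ¬ (‖x‖ ≤ 2 * ‖y‖ ∧ ‖y‖ ≤ 2 * ‖x‖) := fun h => by linarith [h.1, not_lt.1 hy]
      simp [nearKernel, this]
  have hm3 : Measurable fun x => ∫⁻ y, nearKernel d x y * g y ^ 2 := hm2.lintegral_prod_right'
  have hm4 : Measurable fun y => (‖y‖ₑ * g y) ^ 2 := (measurable_enorm.mul hg).pow_const 2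
  calc _ ≤ ∫⁻ x in {x | R ≤ ‖x‖}, c * ∫⁻ y, nearKernel d x y * g y ^ 2 :=
        setLIntegral_mono (hm3.const_mul c) hpt
    _ = c * ∫⁻ y, ∫⁻ x in {x | R ≤ ‖x‖}, nearKernel d x y * g y ^ 2 := by
        rw [lintegral_const_mul _ hm3, lintegral_lintegral_swap
          hm2.aemeasurable]
    _ ≤ c * ∫⁻ y, {y : Ed d | R / 4 < ‖y‖}.indicator (fun y => c * (‖y‖ₑ * g y) ^ 2) y :=
        mul_le_mul_right (lintegral_mono hinner) _
    _ = _ := by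
        rw [lintegral_indicator hmT, lintegral_const_mul _ hm4,
          sq c, mul_assoc]

/-! ### The far part of the potential -/

theorem exists_lintegral_multipoleWeight_le (d J : ℕ) [NeZero d] {γ : ℝ}
    (h₁ : (J : ℝ) + d - γ - 2 < 0) (h₂ : 0 < ((J + 1 : ℕ) : ℝ) + d - γ - 2) :
    ∃ C, 0 ≤ C ∧ ∀ g : Ed d → ℝ≥0∞, Measurable g →
      (∀ R, 0 < R → ∫⁻ y in {y | R < ‖y‖}, (‖y‖ₑ * g y) ^ 2 ≤
        ENNReal.ofReal (R ^ ((d : ℝ) - 2 * γ - 2))) →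
      ∀ x : Ed d, x ≠ 0 → ∫⁻ y, ENNReal.ofReal (multipoleWeight d J x y) * g y ≤
        ENNReal.ofReal (C * ‖x‖ ^ (-γ)) := by
  set M : ℕ → ℝ := fun s => 2 ^ s * (2 ^ d * volume.real (ball (0 : Ed d) 1)) ^ (2⁻¹ : ℝ)
  have hM : ∀ s, 0 ≤ M s := fun s => by positivity
  set A := M (J + 1) / (2 ^ (((J + 1 : ℕ) : ℝ) + d - γ - 2) - 1)
  set B := M J / (1 - 2 ^ ((J : ℝ) + d - γ - 2))
  have hA : 0 ≤ A := div_nonneg (hM _) (by linarith [one_lt_rpow one_lt_two h₂])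
  have hB : 0 ≤ B :=
    div_nonneg (hM _) (by linarith [rpow_lt_one_of_one_lt_of_neg one_lt_two h₁])
  refine ⟨A + B, by positivity, fun g hg H x hx => ?_⟩
  have hn : 0 < ‖x‖ := norm_pos_iff.2 hx
  have hmS : MeasurableSet {y : Ed d | ‖y‖ ≤ ‖x‖} :=
    measurableSet_le measurable_norm measurable_const
  have hcompl : {y : Ed d | ‖y‖ ≤ ‖x‖}ᶜ = {y | ‖x‖ < ‖y‖} := by
    ext y
    simp
  have hmom : ∀ s : ℕ, Measurable fun y => ‖y‖ₑ ^ s * g y := fun s =>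
    (measurable_enorm.pow_const s).mul hg
  have key : ∀ (s : ℕ) (p : ℝ) (S : Set (Ed d)) (K : ℝ), MeasurableSet S → 0 ≤ K →
      p + (s + d - γ - 2) = -γ →
      (∀ y ∈ S, multipoleWeight d J x y = ‖x‖ ^ p * ‖y‖ ^ s) →
      ∫⁻ y in S, ‖y‖ₑ ^ s * g y ≤ ENNReal.ofReal (K * ‖x‖ ^ (s + d - γ - 2 : ℝ)) →
      ∫⁻ y in S, ENNReal.ofReal (multipoleWeight d J x y) * g y ≤
        ENNReal.ofReal (K * ‖x‖ ^ (-γ)) := fun s p S K hS hK hp hw hle => by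
    have e : ∫⁻ y in S, ENNReal.ofReal (multipoleWeight d J x y) * g y =
        ENNReal.ofReal (‖x‖ ^ p) * ∫⁻ y in S, ‖y‖ₑ ^ s * g y := by
      rw [← lintegral_const_mul _ (hmom s)]
      refine setLIntegral_congr_fun hS fun y hy => ?_
      simp only [hw y hy]
      rw [ENNReal.ofReal_mul (by positivity), ENNReal.ofReal_pow (norm_nonneg y), ofReal_norm,
        mul_assoc]
    rw [e]
    refine (mul_le_mul_right hle _).trans_eq ?_
    rw [← ENNReal.ofReal_mul (by positivity), mul_left_comm, ← rpow_add hn, hp]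
  rw [← lintegral_add_compl _ hmS, hcompl, add_mul, ENNReal.ofReal_add (by positivity)
    (by positivity)]
  refine add_le_add (key (J + 1) (2 - (d : ℝ) - (J + 1 : ℕ)) _ A hmS hA (by ring) (fun y hy => ?_)
    (setLIntegral_norm_le_le_of_dyadicShell (hM _) h₂
      (fun t ht => setLIntegral_dyadicShell_moment_le hg H _ ht) hn))
    (key J (2 - (d : ℝ) - J) _ B (hcompl ▸ hmS.compl) hB (by ring) (fun y hy => ?_)
    (setLIntegral_lt_norm_le_of_dyadicShell (hM _) h₁
      (fun t ht => setLIntegral_dyadicShell_moment_le hg H _ ht) hn))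
  · rw [multipoleWeight, if_pos (by exact hy)]
  · rw [multipoleWeight, if_neg (not_le.2 (by exact hy))]

theorem exists_setLIntegral_norm_rpow_le (d : ℕ) {γ : ℝ} (hγ : (d : ℝ) - 2 * γ - 2 < 0)
    (hγ0 : 0 ≤ γ) :
    ∃ C, 0 ≤ C ∧ ∀ R, 0 < R → ∫⁻ x in {x : Ed d | R ≤ ‖x‖},
      ENNReal.ofReal (‖x‖ ^ (-γ)) ^ 2 * (‖x‖ₑ ^ 2)⁻¹ ≤
        ENNReal.ofReal (C * R ^ ((d : ℝ) - 2 * γ - 2)) := by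
  set D := 2 ^ d * volume.real (ball (0 : Ed d) 1) / (1 - 2 ^ ((d : ℝ) - 2 * γ - 2))
  have hD : 0 ≤ D :=
    div_nonneg (by positivity) (by linarith [rpow_lt_one_of_one_lt_of_neg one_lt_two hγ])
  refine ⟨D * 2⁻¹ ^ ((d : ℝ) - 2 * γ - 2), by positivity, fun R hR => ?_⟩
  have h1 := setLIntegral_lt_norm_le_of_dyadicShell (d := d)
    (h := fun x => ENNReal.ofReal (‖x‖ ^ (-2 * γ - 2)))
    (C := 2 ^ d * volume.real (ball (0 : Ed d) 1)) (by positivity) hγ (fun t ht => by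
      have := setLIntegral_dyadicShell_norm_rpow_le d (p := -2 * γ - 2) (by linarith) ht
      rwa [show -2 * γ - 2 + d = (d : ℝ) - 2 * γ - 2 by ring] at this)
    (by positivity : 0 < 2⁻¹ * R)
  rw [mul_rpow (by norm_num) hR.le, ← mul_assoc] at h1
  refine le_trans ?_ h1
  have hmS : MeasurableSet {x : Ed d | R ≤ ‖x‖} := measurableSet_le measurable_const measurable_norm
  rw [setLIntegral_congr_fun (g := fun x => ENNReal.ofReal (‖x‖ ^ (-2 * γ - 2))) hmS
    fun x hx => ?_]
  · exact lintegral_mono_set fun x (hx : R ≤ ‖x‖) => show 2⁻¹ * R < ‖x‖ by linarith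
  · have hn : 0 < ‖x‖ := hR.trans_le hx
    simp only
    rw [← ofReal_norm, ← ENNReal.ofReal_pow (by positivity), ← ENNReal.ofReal_pow (by positivity),
      ← ENNReal.ofReal_inv_of_pos (by positivity), ← ENNReal.ofReal_mul (by positivity),
      ← rpow_natCast, ← rpow_natCast, ← rpow_mul hn.le, ← rpow_neg hn.le, ← rpow_add hn]
    congr 2
    push_cast
    ring

/-- The weighted `L²` bound for a multipole-corrected Newtonian potential. -/
theorem exists_setLIntegral_multipole_sq_le {d : ℕ} (hd : 3 ≤ d) (J : ℕ) {γ : ℝ}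
    (h₁ : (J : ℝ) + d - γ - 2 < 0) (h₂ : 0 < ((J + 1 : ℕ) : ℝ) + d - γ - 2) :
    ∃ C, 0 ≤ C ∧ ∀ g : Ed d → ℝ≥0∞, Measurable g →
      (∀ R, 0 < R → ∫⁻ y in {y | R < ‖y‖}, (‖y‖ₑ * g y) ^ 2 ≤
        ENNReal.ofReal (R ^ ((d : ℝ) - 2 * γ - 2))) →
      ∀ R, 0 < R → ∫⁻ x in {x | R ≤ ‖x‖},
        (∫⁻ y, ‖multipoleKernel d J x y‖ₑ * g y) ^ 2 * (‖x‖ₑ ^ 2)⁻¹ ≤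
          ENNReal.ofReal (C * R ^ ((d : ℝ) - 2 * γ - 2)) := by
  have : NeZero d := ⟨by omega⟩
  have hd' : (3 : ℝ) ≤ d := by exact_mod_cast hd
  have hJ : (0 : ℝ) ≤ J := J.cast_nonneg
  obtain ⟨A, hA, hAK⟩ := exists_abs_multipoleKernel_le d J hd
  obtain ⟨B, hB, hBW⟩ := exists_lintegral_multipoleWeight_le d J h₁ h₂
  obtain ⟨D, hD, hDR⟩ := exists_setLIntegral_norm_rpow_le d (γ := γ) (by linarith) (by linarith)
  set c := 9 * (2 ^ d * volume.real (ball (0 : Ed d) 1))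
  have hc : 0 ≤ c := by positivity
  set β := (d : ℝ) - 2 * γ - 2
  refine ⟨2 * (c ^ 2 * 4⁻¹ ^ β) + 2 * ((A * B) ^ 2 * D), by positivity, fun g hg H R hR => ?_⟩
  have hmS : MeasurableSet {x : Ed d | R ≤ ‖x‖} := measurableSet_le measurable_const measurable_norm
  have hmk := measurable_nearKernel d
  have hm1 : Measurable fun x => (∫⁻ y, nearKernel d x y * g y) ^ 2 * (‖x‖ₑ ^ 2)⁻¹ :=
    (Measurable.lintegral_prod_right' (f := fun p => nearKernel d p.1 p.2 * g p.2)
      (hmk.mul (hg.comp measurable_snd))).pow_const 2 |>.mul (measurable_enorm.pow_const 2).inv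
  have hm2 : Measurable fun x : Ed d => ENNReal.ofReal (‖x‖ ^ (-γ)) ^ 2 * (‖x‖ₑ ^ 2)⁻¹ :=
    ((measurable_norm.pow_const (-γ)).ennreal_ofReal.pow_const 2).mul
      (measurable_enorm.pow_const 2).inv
  have hpt : ∀ x ∈ {x : Ed d | R ≤ ‖x‖},
      (∫⁻ y, ‖multipoleKernel d J x y‖ₑ * g y) ^ 2 * (‖x‖ₑ ^ 2)⁻¹ ≤
        2 * ((∫⁻ y, nearKernel d x y * g y) ^ 2 * (‖x‖ₑ ^ 2)⁻¹) +
        ENNReal.ofReal (2 * (A * B) ^ 2) *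
          (ENNReal.ofReal (‖x‖ ^ (-γ)) ^ 2 * (‖x‖ₑ ^ 2)⁻¹) := fun x hx => by
    have hx0 : x ≠ 0 := norm_pos_iff.1 (hR.trans_le hx)
    have h1 : ∫⁻ y, ‖multipoleKernel d J x y‖ₑ * g y ≤
        (∫⁻ y, nearKernel d x y * g y) + ENNReal.ofReal (A * B * ‖x‖ ^ (-γ)) := by
      calc _ ≤ ∫⁻ y, (nearKernel d x y * g y +
            ENNReal.ofReal A * (ENNReal.ofReal (multipoleWeight d J x y) * g y)) := by
            refine lintegral_mono fun y => ?_
            simp only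
            rw [← mul_assoc, ← add_mul]
            refine mul_le_mul_left ?_ _
            rw [enorm_eq_ofReal_abs]
            refine (ENNReal.ofReal_le_ofReal (hAK x y hx0)).trans (ENNReal.ofReal_add_le.trans ?_)
            rw [ENNReal.ofReal_mul hA, nearKernel]
            refine add_le_add_left (le_of_eq ?_) _
            split_ifs <;> simp
        _ ≤ _ := by
            rw [lintegral_add_left (f := fun y => nearKernel d x y * g y)
              (hmk.of_uncurry_left.mul hg),
              lintegral_const_mul' _ _ ENNReal.ofReal_ne_top, mul_assoc A,
              ENNReal.ofReal_mul hA]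
            exact add_le_add_right (mul_le_mul_right (hBW g hg H x hx0) _) _
    have h2 : ∀ a b : ℝ≥0∞, (a + b) ^ 2 ≤ 2 * (a ^ 2 + b ^ 2) := fun a b => by
      have h := ENNReal.rpow_add_le_mul_rpow_add_rpow a b (p := 2) (by norm_num)
      rw [show (2 : ℝ) - 1 = 1 by norm_num, ENNReal.rpow_one] at h
      simpa using h
    refine (mul_le_mul_left ((pow_le_pow_left₀ zero_le h1 2).trans (h2 _ _)) _).trans_eq ?_
    rw [ENNReal.ofReal_mul (by positivity), ENNReal.ofReal_mul (p := 2) (by positivity),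
      ENNReal.ofReal_pow (by positivity), ENNReal.ofReal_ofNat]
    ring
  have hnear := (setLIntegral_nearKernel_sq_le hd hg hR).trans
    (mul_le_mul_right (H (R / 4) (by positivity)) _)
  rw [← ENNReal.ofReal_pow hc, ← ENNReal.ofReal_mul (by positivity), div_eq_inv_mul,
    mul_rpow (by norm_num) hR.le] at hnear
  calc _ ≤ ∫⁻ x in {x : Ed d | R ≤ ‖x‖},
        (2 * ((∫⁻ y, nearKernel d x y * g y) ^ 2 * (‖x‖ₑ ^ 2)⁻¹) +
          ENNReal.ofReal (2 * (A * B) ^ 2) *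
            (ENNReal.ofReal (‖x‖ ^ (-γ)) ^ 2 * (‖x‖ₑ ^ 2)⁻¹)) :=
        setLIntegral_mono ((hm1.const_mul 2).add (hm2.const_mul _)) hpt
    _ ≤ 2 * ENNReal.ofReal (c ^ 2 * (4⁻¹ ^ β * R ^ β)) +
        ENNReal.ofReal (2 * (A * B) ^ 2) * ENNReal.ofReal (D * R ^ β) := by
        rw [lintegral_add_left (hm1.const_mul 2), lintegral_const_mul _ hm1,
          lintegral_const_mul _ hm2]
        exact add_le_add (mul_le_mul_right hnear _) (mul_le_mul_right (hDR R hR) _)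
    _ = _ := by
        rw [← ENNReal.ofReal_ofNat 2, ← ENNReal.ofReal_mul (by positivity),
          ← ENNReal.ofReal_mul (by positivity), ← ENNReal.ofReal_add (by positivity)
          (by positivity)]
        ring_nf

/-! ### Assembly of the solution -/

theorem hasLaplacianAt_multipolePotential {d : ℕ} (hd : 3 ≤ d) {J : ℕ} {F : Ed d → ℝ}
    (hF : AEStronglyMeasurable F) (hk : ∀ k ≤ J, Integrable fun y => ‖y‖ ^ k * ‖F y‖)
    {x₀ : Ed d} (hx₀ : x₀ ≠ 0) {r : ℝ} (hr : 0 < r) (hFr : ContDiffOn ℝ 2 F (ball x₀ r)) :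
    HasLaplacianAt (fun x => ∫ y, multipoleKernel d J x y * F y) (-newtonConst d * F x₀) x₀ := by
  have : NeZero d := ⟨by omega⟩
  let χ : ContDiffBump x₀ := ⟨r / 2, 3 * r / 4, by positivity, by linarith⟩
  have hF1 : Integrable F := by
    simpa [← integrable_norm_iff hF] using hk 0 J.zero_le
  have hδ : 0 < r / 4 := by positivity
  set g : Ed d → ℝ := fun y => χ y * F y
  set h : Ed d → ℝ := fun y => (1 - χ y) * F y
  have hgs : tsupport g ⊆ closedBall x₀ (3 * r / 4) :=
    (tsupport_mul_subset_left (f := χ) (g := F)).trans χ.tsupport_eq.subset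
  have hgc : HasCompactSupport g := χ.hasCompactSupport.mul_right
  have hg : ContDiff ℝ 2 g := contDiff_iff_contDiffAt.2 fun y => by
    by_cases hy : y ∈ tsupport g
    swap
    · exact contDiffAt_const.congr_of_eventuallyEq (notMem_tsupport_iff_eventuallyEq.1 hy)
    have hy' : y ∈ ball x₀ r := closedBall_subset_ball (by linarith) (hgs hy)
    exact χ.contDiff.contDiffAt.mul (hFr.contDiffAt (isOpen_ball.mem_nhds hy'))
  have hh : Integrable h := by
    refine hF1.norm.mono' ((continuous_const.sub χ.continuous).aestronglyMeasurable.mul hF)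
      (Eventually.of_forall fun y => ?_)
    rw [norm_mul, Real.norm_of_nonneg (sub_nonneg.2 χ.le_one)]
    exact mul_le_of_le_one_left (norm_nonneg _) (by linarith [χ.nonneg' y])
  have h0 : ∀ y ∈ ball x₀ (2 * (r / 4)), h y = 0 := fun y hy => by
    have : χ y = 1 := χ.one_of_mem_closedBall
      (ball_subset_closedBall (ball_subset_ball (by simp only [χ]; linarith) hy))
    simp [h, this]
  obtain ⟨B, hB⟩ := exists_norm_iteratedFDeriv_newtonKernel_le_of_lt hd 0 hδ
  simp only [norm_iteratedFDeriv_zero] at hB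
  have hcont : ContinuousOn (newtonKernel d 0) {0}ᶜ := fun z hz =>
    (contDiffAt_newtonKernel (n := 0)
      (zero_add_norm_sq_pos hz)).continuousAt.continuousWithinAt
  have hgx : χ x₀ = 1 := χ.one_of_mem_closedBall (mem_closedBall_self χ.rIn_pos.le)
  have hlap := ((hasLaplacianAt_newtonPotential hd hg hgc x₀).add
    (hasLaplacianAt_newtonPotential_of_vanish hd hh hδ h0)).add
    ((HasLaplacianAt.sum (Finset.range (J + 1)) fun k hkJ =>
      (hasLaplacianAt_multipole hF (hk k (Finset.mem_range_succ_iff.1 hkJ)) hx₀).const_mul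
        (k.factorial : ℝ)⁻¹).const_mul (-1))
  simp only [g, hgx, one_mul, mul_zero, add_zero, Finset.sum_const_zero] at hlap
  refine hlap.congr_of_eventuallyEq ?_
  filter_upwards [isOpen_ball.mem_nhds (mem_ball_self hδ)] with x hx
  have i1 : Integrable fun y => newtonKernel d 0 (x - y) * g y := by
    have := (integrable_newtonKernel_mul hd (g := fun z => g (x - z))
      (hg.continuous.comp (by fun_prop))
      (hgc.comp_homeomorph (Homeomorph.subLeft x))).comp_sub_left x
    simpa only [sub_sub_cancel] using this
  have i2 : Integrable fun y => newtonKernel d 0 (x - y) * h y := by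
    simpa only [smul_eq_mul, mul_comm] using
      integrable_smul_comp_sub_of_vanish hcont hh hB h0 hx
  have i3 : ∀ k ∈ Finset.range (J + 1), Integrable fun y => (k.factorial : ℝ)⁻¹ *
      (iteratedFDeriv ℝ k (newtonKernel d 0) x (fun _ => -y) * F y) := fun k hkJ =>
    (integrable_apply_neg_mul hF (hk k (Finset.mem_range_succ_iff.1 hkJ)) _).const_mul _
  have e : ∀ y, multipoleKernel d J x y * F y =
      newtonKernel d 0 (x - y) * g y + newtonKernel d 0 (x - y) * h y -
        ∑ k ∈ Finset.range (J + 1), (k.factorial : ℝ)⁻¹ *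
          (iteratedFDeriv ℝ k (newtonKernel d 0) x (fun _ => -y) * F y) := fun y => by
    simp only [multipoleKernel, g, h, sub_mul, Finset.sum_mul, mul_assoc]
    ring
  simp only [e]
  rw [integral_sub (by exact i1.add i2) (integrable_finsetSum _ i3), integral_add i1 i2,
    integral_finsetSum _ i3]
  simp only [integral_const_mul, g, h]
  ring

theorem integrable_norm_pow_mul_norm {d : ℕ} {F : Ed d → ℝ} (hF : Measurable F)
    (h0 : ∀ y, ‖y‖ ≤ 1 → F y = 0) {γ : ℝ}
    (H : ∀ R, 0 < R → ∫⁻ y in {y : Ed d | R < ‖y‖}, (‖y‖ₑ * ‖F y‖ₑ) ^ 2 ≤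
      ENNReal.ofReal (R ^ ((d : ℝ) - 2 * γ - 2))) {k : ℕ} (hk : (k : ℝ) + d - γ - 2 < 0) :
    Integrable fun y => ‖y‖ ^ k * ‖F y‖ := by
  refine ⟨((measurable_norm.pow_const k).mul hF.norm).aestronglyMeasurable, ?_⟩
  have h1 := setLIntegral_lt_norm_le_of_dyadicShell (by positivity) hk
    (fun t ht => setLIntegral_dyadicShell_moment_le hF.enorm H k ht) one_pos
  have hm : MeasurableSet {y : Ed d | 1 < ‖y‖} := measurableSet_lt measurable_const measurable_norm
  rw [← lintegral_indicator hm] at h1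
  refine lt_of_le_of_lt ((lintegral_mono fun y => ?_).trans h1) ENNReal.ofReal_lt_top
  by_cases hy : 1 < ‖y‖
  · rw [Set.indicator_of_mem (by exact hy)]
    simp [enorm_mul, enorm_pow]
  · simp [h0 y (not_lt.1 hy)]

theorem setLIntegral_norm_mul_indicator_sq_le {d : ℕ} {f : Ed d → ℝ} {β : ℝ} (hβ : β ≤ 0)
    (H : ∀ R : ℝ, 1 ≤ R → (∫⁻ x in {x : Ed d | R < ‖x‖}, ENNReal.ofReal (‖x‖ ^ 2 * f x ^ 2)) ≤
      ENNReal.ofReal (R ^ β)) {R : ℝ} (hR : 0 < R) :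
    ∫⁻ y in {y : Ed d | R < ‖y‖}, (‖y‖ₑ * ‖{x : Ed d | 1 < ‖x‖}.indicator f y‖ₑ) ^ 2 ≤
      ENNReal.ofReal (R ^ β) := by
  have hm : ∀ R : ℝ, MeasurableSet {y : Ed d | R < ‖y‖} := fun R =>
    measurableSet_lt measurable_const measurable_norm
  have e : ∀ y, (‖y‖ₑ * ‖{x : Ed d | 1 < ‖x‖}.indicator f y‖ₑ) ^ 2 =
      {x : Ed d | 1 < ‖x‖}.indicator (fun x => ENNReal.ofReal (‖x‖ ^ 2 * f x ^ 2)) y := fun y => by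
    by_cases hy : y ∈ {x : Ed d | 1 < ‖x‖}
    · rw [Set.indicator_of_mem hy, Set.indicator_of_mem hy, ← mul_pow, ← sq_abs, abs_mul, abs_norm,
        ENNReal.ofReal_pow (by positivity), ENNReal.ofReal_mul (norm_nonneg y), ofReal_norm,
        ← enorm_eq_ofReal_abs]
    · simp [Set.indicator_of_notMem hy]
  simp only [e]
  rw [← lintegral_indicator (hm R)]
  have hle : ∀ y, {y : Ed d | R < ‖y‖}.indicator ({x : Ed d | 1 < ‖x‖}.indicator
      fun x => ENNReal.ofReal (‖x‖ ^ 2 * f x ^ 2)) y ≤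
      {y : Ed d | max R 1 < ‖y‖}.indicator (fun x => ENNReal.ofReal (‖x‖ ^ 2 * f x ^ 2)) y :=
    fun y => by
    rw [Set.indicator_indicator]
    refine (congrFun (congrArg (Set.indicator · _) ?_) y).le
    ext z
    simp
  refine (lintegral_mono hle).trans ?_
  rw [lintegral_indicator (hm _)]
  exact (H _ (le_max_right _ _)).trans
    (ENNReal.ofReal_le_ofReal (rpow_le_rpow_of_nonpos hR (le_max_left _ _) hβ))

/-- **Weighted `L²` decay for Poisson's equation in an exterior domain (Lemma A.2).**
Let `d ≥ 3`, `γ > d−2`, `γ ∉ ℕ`. There is `C = C(d, γ) > 0` such that for every `f` on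
`ℝ^d∖B₁` with `(R^{−d} ∫_{|x|>R} |x|² f² dx)^{1/2} ≤ R^{−(γ+1)}` for all `R ≥ 1`
(i.e. `∫_{|x|>R} |x|² f² ≤ R^{d−2γ−2}`), there exists `u` with `Δu = f` in `ℝ^d∖B₁` and
`(R^{−d} ∫_{|x|≥R} |u|²/|x|² dx)^{1/2} ≤ C R^{−(γ+1)}` for all `R ≥ 1`
(i.e. `∫_{|x|≥R} |u|²/|x|² ≤ C² R^{d−2γ−2}`). -/
theorem poisson_L2_decay (d : ℕ) (hd : 3 ≤ d) (γ : ℝ)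
    (hγ : (d : ℝ) - 2 < γ) (hγN : ∀ k : ℕ, γ ≠ k) :
    ∃ C : ℝ, 0 < C ∧
      ∀ f : Ed d → ℝ, ContDiffOn ℝ (⊤ : ℕ∞) f {x : Ed d | 1 < ‖x‖} →
        (∀ R : ℝ, 1 ≤ R →
          (∫⁻ x in {x : Ed d | R < ‖x‖}, ENNReal.ofReal (‖x‖ ^ 2 * f x ^ 2))
            ≤ ENNReal.ofReal (R ^ ((d : ℝ) - 2 * γ - 2))) →
        ∃ u : Ed d → ℝ,
          (∀ x : Ed d, 1 < ‖x‖ → lapScalar d u x = f x) ∧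
          ∀ R : ℝ, 1 ≤ R →
            (∫⁻ x in {x : Ed d | R ≤ ‖x‖}, ENNReal.ofReal (u x ^ 2 / ‖x‖ ^ 2))
              ≤ ENNReal.ofReal (C ^ 2 * R ^ ((d : ℝ) - 2 * γ - 2)) := by
  have hd' : (3 : ℝ) ≤ d := by exact_mod_cast hd
  have hγ0 : 0 ≤ γ := by linarith
  have hfl : d - 2 ≤ ⌊γ⌋₊ := Nat.le_floor (by
    rw [Nat.cast_sub (by omega)]
    exact_mod_cast hγ.le)
  obtain ⟨J, hJ⟩ := Nat.exists_eq_add_of_le hfl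
  have hJ' : (⌊γ⌋₊ : ℝ) = d - 2 + J := by
    rw [hJ, Nat.cast_add, Nat.cast_sub (by omega), Nat.cast_ofNat]
  have hlt : (⌊γ⌋₊ : ℝ) < γ := (Nat.floor_le hγ0).lt_of_ne (hγN _).symm
  have h₁ : (J : ℝ) + d - γ - 2 < 0 := by linarith
  have h₂ : 0 < ((J + 1 : ℕ) : ℝ) + d - γ - 2 := by
    push_cast
    linarith [Nat.lt_floor_add_one γ]
  obtain ⟨D, hD, hDle⟩ := exists_setLIntegral_multipole_sq_le hd J h₁ h₂
  have hκ := newtonConst_pos hd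
  set κ := newtonConst d
  have hC : κ⁻¹ ^ 2 * D ≤ (√(κ⁻¹ ^ 2 * D) + 1) ^ 2 := by
    have h := Real.sq_sqrt (by positivity : 0 ≤ κ⁻¹ ^ 2 * D)
    have h' := Real.sqrt_nonneg (κ⁻¹ ^ 2 * D)
    nlinarith
  refine ⟨√(κ⁻¹ ^ 2 * D) + 1, by positivity, fun f hf hdecay => ?_⟩
  have hU : IsOpen {x : Ed d | 1 < ‖x‖} := isOpen_lt continuous_const continuous_norm
  set F := {x : Ed d | 1 < ‖x‖}.indicator f with hFdef
  have hF : Measurable F := by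
    classical
    rw [hFdef, ← Set.piecewise_eq_indicator]
    exact hf.continuousOn.measurable_piecewise continuousOn_const hU.measurableSet
  have hF0 : ∀ y, ‖y‖ ≤ 1 → F y = 0 := fun y hy => Set.indicator_of_notMem (by simpa using hy) f
  have H : ∀ R, 0 < R → ∫⁻ y in {y : Ed d | R < ‖y‖}, (‖y‖ₑ * ‖F y‖ₑ) ^ 2 ≤
      ENNReal.ofReal (R ^ ((d : ℝ) - 2 * γ - 2)) := fun R hR =>
    setLIntegral_norm_mul_indicator_sq_le (by linarith) hdecay hR
  have h_int : ∀ k ≤ J, Integrable fun y => ‖y‖ ^ k * ‖F y‖ := fun k hk => by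
    have : (k : ℝ) ≤ J := by exact_mod_cast hk
    exact integrable_norm_pow_mul_norm hF hF0 H (by linarith)
  refine ⟨fun x => -κ⁻¹ * ∫ y, multipoleKernel d J x y * F y, fun x hx => ?_, fun R hR => ?_⟩
  · obtain ⟨r, hr, hrU⟩ := Metric.isOpen_iff.1 hU x hx
    have hFr : ContDiffOn ℝ 2 F (ball x r) :=
      ((hf.of_le (WithTop.coe_le_coe.2 le_top : ((2 : ℕ∞) : WithTop ℕ∞) ≤ _)).mono hrU).congr
        fun y hy => Set.indicator_of_mem (hrU hy) f
    have hx0 : x ≠ 0 := norm_pos_iff.1 (one_pos.trans hx)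
    rw [((hasLaplacianAt_multipolePotential hd hF.aestronglyMeasurable h_int hx0 hr
      hFr).const_mul (-κ⁻¹)).lapScalar_eq, ← mul_assoc, neg_mul_neg,
      inv_mul_cancel₀ hκ.ne', one_mul]
    exact Set.indicator_of_mem (by exact hx) f
  · have hR0 : 0 < R := one_pos.trans_le hR
    have hpt : ∀ x ∈ {x : Ed d | R ≤ ‖x‖},
        ENNReal.ofReal ((-κ⁻¹ * ∫ y, multipoleKernel d J x y * F y) ^ 2 / ‖x‖ ^ 2) ≤
          ENNReal.ofReal (κ⁻¹ ^ 2) *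
            ((∫⁻ y, ‖multipoleKernel d J x y‖ₑ * ‖F y‖ₑ) ^ 2 * (‖x‖ₑ ^ 2)⁻¹) := fun x hx => by
      have hn : 0 < ‖x‖ := hR0.trans_le hx
      have h1 : ‖∫ y, multipoleKernel d J x y * F y‖ₑ ≤
          ∫⁻ y, ‖multipoleKernel d J x y‖ₑ * ‖F y‖ₑ := by
        simpa only [enorm_mul] using
          enorm_integral_le_lintegral_enorm fun y => multipoleKernel d J x y * F y
      rw [mul_pow, neg_sq, div_eq_mul_inv, mul_assoc, ENNReal.ofReal_mul (by positivity),
        ENNReal.ofReal_mul (by positivity), ENNReal.ofReal_inv_of_pos (by positivity),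
        ENNReal.ofReal_pow hn.le, ofReal_norm, ← sq_abs (∫ y, _),
        ENNReal.ofReal_pow (abs_nonneg _), ← enorm_eq_ofReal_abs]
      gcongr
    refine (setLIntegral_mono' (measurableSet_le measurable_const measurable_norm) hpt).trans ?_
    rw [lintegral_const_mul' _ _ ENNReal.ofReal_ne_top]
    refine (mul_le_mul_right (hDle _ hF.enorm H R hR0) _).trans ?_
    rw [← ENNReal.ofReal_mul (by positivity), ← mul_assoc]
    exact ENNReal.ofReal_le_ofReal (mul_le_mul_of_nonneg_right hC (by positivity))

end
end

section
/- Let R₀ ≥ 1 and let n : ℝ³∖B̄_{R₀} → S² be a smooth solution of the harmonic map equation −Δn = |∇n|² n satisfying the pointwise bound |∇n(x)|² ≤ K |x|^{−3}. Then for each k ∈ {1,2,3}, the derivative w = ∂_k n (which solves −Δw = 2(∇n : ∇w) n + |∇n|² w) satisfies ∫_{|x|≥R} |∇w|² ≤ C / R² for all R ≥ 2R₀, where C depends only on K. -/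
open MeasureTheory Filter Metric Real
open scoped ENNReal NNReal Topology

noncomputable section

/-- Three-dimensional Euclidean space. -/
abbrev E3 : Type := EuclideanSpace ℝ (Fin 3)

/-- `|∇f|²`, the squared Frobenius norm of the gradient of `f`. -/
def gradSq (f : E3 → E3) (x : E3) : ℝ :=
  ∑ i : Fin 3, ‖fderiv ℝ f x (EuclideanSpace.single i (1 : ℝ))‖ ^ 2

/-- The (componentwise) Laplacian `Δf = Σ_i ∂²_{ii} f`. -/
def lap3 (f : E3 → E3) (x : E3) : E3 :=
  ∑ i : Fin 3, iteratedFDeriv ℝ 2 f x (fun _ => EuclideanSpace.single i (1 : ℝ))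

/-- The `i`-th partial derivative of `f`. -/
abbrev partialD {F : Type*} [NormedAddCommGroup F] [NormedSpace ℝ F] (f : E3 → F) (i : Fin 3)
    (x : E3) : F :=
  fderiv ℝ f x (EuclideanSpace.single i (1 : ℝ))

section PartialDerivatives

variable {F : Type*} [NormedAddCommGroup F] [NormedSpace ℝ F]

lemma contDiffOn_partialD {f : E3 → F} {U : Set E3} (hU : IsOpen U)
    (hf : ContDiffOn ℝ (⊤ : ℕ∞) f U) (i : Fin 3) : ContDiffOn ℝ (⊤ : ℕ∞) (partialD f i) U :=
  (hf.fderiv_of_isOpen hU (by simp)).clm_apply contDiffOn_const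

lemma differentiableAt_of_contDiffOn {f : E3 → F} {U : Set E3} (hU : IsOpen U)
    (hf : ContDiffOn ℝ (⊤ : ℕ∞) f U) {x : E3} (hx : x ∈ U) : DifferentiableAt ℝ f x :=
  (hf.contDiffAt (hU.mem_nhds hx)).differentiableAt (by simp)

lemma partialD_congr {f g : E3 → F} {U : Set E3} (hU : IsOpen U) (h : Set.EqOn f g U)
    (i : Fin 3) : Set.EqOn (partialD f i) (partialD g i) U := fun x hx => by
  have : f =ᶠ[𝓝 x] g := h.eventuallyEq_of_mem (hU.mem_nhds hx)
  simp only [partialD, this.fderiv_eq]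

lemma partialD_partialD {f : E3 → F} {U : Set E3} (hU : IsOpen U)
    (hf : ContDiffOn ℝ (⊤ : ℕ∞) f U) {x : E3} (hx : x ∈ U) (i j : Fin 3) :
    partialD (partialD f i) j x = fderiv ℝ (fderiv ℝ f) x (EuclideanSpace.single j 1)
      (EuclideanSpace.single i 1) := by
  have hd : DifferentiableAt ℝ (fderiv ℝ f) x :=
    ((hf.fderiv_of_isOpen hU (m := (⊤ : ℕ∞)) (by simp)).contDiffAt
      (hU.mem_nhds hx)).differentiableAt (by simp)
  simp [partialD, fderiv_clm_apply hd (differentiableAt_const _)]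

lemma partialD_comm {f : E3 → F} {U : Set E3} (hU : IsOpen U)
    (hf : ContDiffOn ℝ (⊤ : ℕ∞) f U) (i j : Fin 3) :
    Set.EqOn (partialD (partialD f i) j) (partialD (partialD f j) i) U := fun x hx => by
  rw [partialD_partialD hU hf hx, partialD_partialD hU hf hx]
  exact (hf.contDiffAt (hU.mem_nhds hx)).isSymmSndFDerivAt
    (by simpa using WithTop.coe_le_coe.2 (le_top : (2 : ℕ∞) ≤ ⊤)) _ _

lemma partialD_comp_smul (f : E3 → F) (c : ℝ) (i : Fin 3) (x : E3) :
    partialD (fun y => f (c • y)) i x = c • partialD f i (c • x) := by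
  simp [partialD, fderiv_comp_smul]

end PartialDerivatives

lemma lap3_eq_sum_partialD {f : E3 → E3} {U : Set E3} (hU : IsOpen U)
    (hf : ContDiffOn ℝ (⊤ : ℕ∞) f U) {x : E3} (hx : x ∈ U) :
    lap3 f x = ∑ i, partialD (partialD f i) i x := by
  simp only [lap3, iteratedFDeriv_two_apply, partialD_partialD hU hf hx]

lemma contDiffOn_gradSq {f : E3 → E3} {U : Set E3} (hU : IsOpen U)
    (hf : ContDiffOn ℝ (⊤ : ℕ∞) f U) : ContDiffOn ℝ (⊤ : ℕ∞) (gradSq f) U :=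
  ContDiffOn.sum fun i _ => (contDiffOn_partialD hU hf i).norm_sq ℝ

lemma gradSq_nonneg (f : E3 → E3) (x : E3) : 0 ≤ gradSq f x :=
  Finset.sum_nonneg fun _ _ => sq_nonneg _

lemma norm_partialD_sq_le_gradSq (f : E3 → E3) (k : Fin 3) (x : E3) :
    ‖partialD f k x‖ ^ 2 ≤ gradSq f x :=
  Finset.single_le_sum (f := fun i => ‖partialD f i x‖ ^ 2) (fun _ _ => sq_nonneg _)
    (Finset.mem_univ k)

lemma partialD_inner {f g : E3 → E3} {x : E3} (hf : DifferentiableAt ℝ f x)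
    (hg : DifferentiableAt ℝ g x) (i : Fin 3) :
    partialD (fun y => inner ℝ (f y) (g y)) i x =
      inner ℝ (f x) (partialD g i x) + inner ℝ (partialD f i x) (g x) :=
  fderiv_inner_apply ℝ hf hg _

/-- Bochner identity `Δ|w|² = 2|∇w|² + 2⟨w, Δw⟩`. -/
lemma laplacian_norm_sq {w : E3 → E3} {U : Set E3} (hU : IsOpen U)
    (hw : ContDiffOn ℝ (⊤ : ℕ∞) w U) {x : E3} (hx : x ∈ U) :
    ∑ i, partialD (partialD (fun y => ‖w y‖ ^ 2) i) i x =
      2 * gradSq w x + 2 * inner ℝ (w x) (∑ i, partialD (partialD w i) i x) := by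
  rw [inner_sum, Finset.mul_sum, gradSq, Finset.mul_sum, ← Finset.sum_add_distrib]
  refine Finset.sum_congr rfl fun i _ => ?_
  have h1 : Set.EqOn (partialD (fun y => ‖w y‖ ^ 2) i)
      (fun y => 2 * inner ℝ (w y) (partialD w i y)) U := fun y hy => by
    have hd := differentiableAt_of_contDiffOn hU hw hy
    have := partialD_inner hd hd i
    simp only [real_inner_self_eq_norm_sq] at this
    rw [this, real_inner_comm (w y) (partialD w i y)]
    ring
  have hd := differentiableAt_of_contDiffOn hU hw hx
  have hd' := differentiableAt_of_contDiffOn hU (contDiffOn_partialD hU hw i) hx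
  rw [partialD_congr hU h1 i hx]
  have h2 : partialD (fun y => 2 * inner ℝ (w y) (partialD w i y)) i x =
      2 * partialD (fun y => inner ℝ (w y) (partialD w i y)) i x := by
    simp only [partialD]
    rw [fderiv_const_mul (hd.inner ℝ hd')]
    simp
  rw [h2, partialD_inner hd hd', real_inner_self_eq_norm_sq]
  ring

/-- The derivative `w = ∂ₖn` of a harmonic map satisfies `⟨w, Δw⟩ = -|∇n|²|w|²`, since `w ⟂ n`. -/
lemma inner_laplacian_partialD_of_harmonic {n : E3 → E3} {U : Set E3} (hU : IsOpen U)
    (hn : ContDiffOn ℝ (⊤ : ℕ∞) n U) (hunit : ∀ x ∈ U, ‖n x‖ = 1)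
    (hlap : ∀ x ∈ U, lap3 n x = -(gradSq n x • n x)) (k : Fin 3) {x : E3} (hx : x ∈ U) :
    inner ℝ (partialD n k x) (∑ i, partialD (partialD (partialD n k) i) i x) =
      -(gradSq n x * ‖partialD n k x‖ ^ 2) := by
  have hdn := differentiableAt_of_contDiffOn hU hn hx
  have horth : inner ℝ (partialD n k x) (n x) = 0 := by
    have h1 : Set.EqOn (fun y => inner ℝ (n y) (n y)) (fun _ => (1 : ℝ)) U := fun y hy => by
      simp [hunit y hy]
    have h2 := partialD_congr hU h1 k hx
    rw [partialD_inner hdn hdn, real_inner_comm (partialD n k x) (n x)] at h2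
    simp only [partialD, fderiv_fun_const, Pi.zero_apply, zero_apply] at h2
    linarith
  have hcomm : ∀ i, partialD (partialD (partialD n k) i) i x =
      partialD (partialD (partialD n i) i) k x := fun i => by
    rw [partialD_congr hU (partialD_comm hU hn k i) i hx,
      partialD_comm hU (contDiffOn_partialD hU hn i) k i hx]
  have hsum : ∑ i, partialD (partialD (partialD n i) i) k x =
      partialD (fun y => ∑ i, partialD (partialD n i) i y) k x := by
    simp only [partialD]
    rw [fderiv_fun_sum fun i _ => differentiableAt_of_contDiffOn hU
      (contDiffOn_partialD hU (contDiffOn_partialD hU hn i) i) hx]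
    simp
  have heq : Set.EqOn (fun y => ∑ i, partialD (partialD n i) i y)
      (fun y => -(gradSq n y • n y)) U := fun y hy => by
    simp only [← hlap y hy, lap3_eq_sum_partialD hU hn hy]
  have hdg := differentiableAt_of_contDiffOn hU (contDiffOn_gradSq hU hn) hx
  have hprod : partialD (fun y => -(gradSq n y • n y)) k x =
      -(gradSq n x • partialD n k x + partialD (gradSq n) k x • n x) := by
    simp only [partialD]
    rw [fderiv_fun_neg, fderiv_fun_smul hdg hdn]
    simp
  rw [Finset.sum_congr rfl fun i _ => hcomm i, hsum, partialD_congr hU heq k hx, hprod,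
    inner_neg_right, inner_add_right, inner_smul_right, inner_smul_right, horth,
    real_inner_self_eq_norm_sq]
  ring

lemma continuous_mul_of_tsupport_subset {f g : E3 → ℝ} {U : Set E3} (hU : IsOpen U)
    (hf : Continuous f) (hfU : tsupport f ⊆ U) (hg : ContinuousOn g U) :
    Continuous fun x => f x * g x :=
  continuous_of_tsupport fun _ hx =>
    hf.continuousAt.mul (hg.continuousAt (hU.mem_nhds (hfU (tsupport_mul_subset_left hx))))

lemma integrable_mul_of_tsupport_subset {f g : E3 → ℝ} {U : Set E3} (hU : IsOpen U)
    (hf : Continuous f) (hc : HasCompactSupport f) (hfU : tsupport f ⊆ U)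
    (hg : ContinuousOn g U) : Integrable fun x => f x * g x :=
  (continuous_mul_of_tsupport_subset hU hf hfU hg).integrable_of_hasCompactSupport hc.mul_right

section Green

variable {ψ h : E3 → ℝ} {U : Set E3}

lemma contDiff_partialD (hψ : ContDiff ℝ (⊤ : ℕ∞) ψ) (i : Fin 3) :
    ContDiff ℝ (⊤ : ℕ∞) (partialD ψ i) :=
  (hψ.fderiv_right (by simp)).clm_apply contDiff_const

lemma tsupport_partialD_subset (ψ : E3 → ℝ) (i : Fin 3) : tsupport (partialD ψ i) ⊆ tsupport ψ :=
  tsupport_fderiv_apply_subset ℝ _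

lemma integral_mul_partialD (hU : IsOpen U) (hψ : ContDiff ℝ (⊤ : ℕ∞) ψ)
    (hc : HasCompactSupport ψ) (hψU : tsupport ψ ⊆ U) (hh : ContDiffOn ℝ (⊤ : ℕ∞) h U)
    (i : Fin 3) : ∫ x, ψ x * partialD h i x = -∫ x, partialD ψ i x * h x :=
  integral_mul_fderiv_eq_neg_fderiv_mul_of_integrable
    (integrable_mul_of_tsupport_subset hU (contDiff_partialD hψ i).continuous
      (hc.fderiv_apply ℝ _) ((tsupport_partialD_subset ψ i).trans hψU) hh.continuousOn)
    (integrable_mul_of_tsupport_subset hU hψ.continuous hc hψU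
      (contDiffOn_partialD hU hh i).continuousOn)
    (integrable_mul_of_tsupport_subset hU hψ.continuous hc hψU hh.continuousOn)
    (fun x _ => hψ.differentiable (by simp) x)
    (fun x hx => differentiableAt_of_contDiffOn hU hh (hψU hx))

/-- Green's identity `∫ ψ Δh = ∫ Δψ h` for a test function `ψ` supported where `h` is smooth. -/
lemma integral_mul_laplacian (hU : IsOpen U) (hψ : ContDiff ℝ (⊤ : ℕ∞) ψ)
    (hc : HasCompactSupport ψ) (hψU : tsupport ψ ⊆ U) (hh : ContDiffOn ℝ (⊤ : ℕ∞) h U) :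
    ∫ x, ψ x * ∑ i, partialD (partialD h i) i x =
      ∫ x, (∑ i, partialD (partialD ψ i) i x) * h x := by
  simp only [Finset.mul_sum, Finset.sum_mul]
  have hsub := fun i => (tsupport_partialD_subset ψ i).trans hψU
  have hc' := fun i : Fin 3 => hc.fderiv_apply ℝ (EuclideanSpace.single i (1 : ℝ))
  rw [integral_finsetSum, integral_finsetSum]
  · refine Finset.sum_congr rfl fun i _ => ?_
    rw [integral_mul_partialD hU hψ hc hψU (contDiffOn_partialD hU hh i),
      integral_mul_partialD hU (contDiff_partialD hψ i) (hc' i) (hsub i) hh, neg_neg]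
  · exact fun i _ => integrable_mul_of_tsupport_subset hU
      (contDiff_partialD (contDiff_partialD hψ i) i).continuous ((hc' i).fderiv_apply ℝ _)
      ((tsupport_partialD_subset _ i).trans (hsub i)) hh.continuousOn
  · exact fun i _ => integrable_mul_of_tsupport_subset hU hψ.continuous hc hψU
      (contDiffOn_partialD hU (contDiffOn_partialD hU hh i) i).continuousOn

end Green

/-- Testing the equation for `w = ∂ₖn` with `ψ w`. -/
lemma integral_mul_gradSq_partialD {n : E3 → E3} {U : Set E3} (hU : IsOpen U)
    (hn : ContDiffOn ℝ (⊤ : ℕ∞) n U) (hunit : ∀ x ∈ U, ‖n x‖ = 1)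
    (hlap : ∀ x ∈ U, lap3 n x = -(gradSq n x • n x)) (k : Fin 3) {ψ : E3 → ℝ}
    (hψ : ContDiff ℝ (⊤ : ℕ∞) ψ) (hc : HasCompactSupport ψ) (hψU : tsupport ψ ⊆ U) :
    ∫ x, ψ x * gradSq (partialD n k) x =
      ∫ x, ((∑ i, partialD (partialD ψ i) i x) / 2 + ψ x * gradSq n x) *
        ‖partialD n k x‖ ^ 2 := by
  have hw := contDiffOn_partialD hU hn k
  have hh : ContDiffOn ℝ (⊤ : ℕ∞) (fun x => ‖partialD n k x‖ ^ 2) U := hw.norm_sq ℝ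
  have hgreen := integral_mul_laplacian hU hψ hc hψU hh
  have hg := contDiffOn_gradSq hU hn
  have hpt : ∀ x, ψ x * gradSq (partialD n k) x =
      (1 / 2) * (ψ x * ∑ i, partialD (partialD (fun y => ‖partialD n k y‖ ^ 2) i) i x) +
        ψ x * (gradSq n x * ‖partialD n k x‖ ^ 2) := fun x => by
    by_cases hx : x ∈ U
    · rw [laplacian_norm_sq hU hw hx, inner_laplacian_partialD_of_harmonic hU hn hunit hlap k hx]
      ring
    · simp [image_eq_zero_of_notMem_tsupport fun h => hx (hψU h)]
  have hI1 : Integrable fun x =>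
      ψ x * ∑ i, partialD (partialD (fun y => ‖partialD n k y‖ ^ 2) i) i x :=
    integrable_mul_of_tsupport_subset hU hψ.continuous hc hψU
      (continuousOn_finsetSum _ fun i _ =>
        (contDiffOn_partialD hU (contDiffOn_partialD hU hh i) i).continuousOn)
  have hI2 : Integrable fun x => ψ x * (gradSq n x * ‖partialD n k x‖ ^ 2) :=
    integrable_mul_of_tsupport_subset hU hψ.continuous hc hψU (hg.mul hh).continuousOn
  have hI3 : Integrable fun x =>
      (∑ i, partialD (partialD ψ i) i x) * ‖partialD n k x‖ ^ 2 := by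
    simp only [Finset.sum_mul]
    exact integrable_finsetSum _ fun i _ => integrable_mul_of_tsupport_subset hU
      (contDiff_partialD (contDiff_partialD hψ i) i).continuous
      ((hc.fderiv_apply ℝ _).fderiv_apply ℝ _)
      ((tsupport_partialD_subset _ i).trans ((tsupport_partialD_subset ψ i).trans hψU))
      hh.continuousOn
  simp only [hpt]
  rw [integral_add (hI1.const_mul _) hI2, integral_const_mul, hgreen, ← integral_const_mul,
    ← integral_add (hI3.const_mul _) hI2]
  refine integral_congr_ae (ae_of_all _ fun x => ?_)
  simp only
  ring

/-- A smooth cutoff equal to one on the annulus `1 ≤ |x| ≤ 2`, vanishing outside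
`3/4 < |x| < 3`. -/
lemma exists_annulus_cutoff : ∃ ψ : E3 → ℝ, ContDiff ℝ (⊤ : ℕ∞) ψ ∧
    (∀ x, ψ x ∈ Set.Icc 0 1) ∧ (∀ x, 1 ≤ ‖x‖ → ‖x‖ ≤ 2 → ψ x = 1) ∧
    tsupport ψ ⊆ {x | 3 / 4 ≤ ‖x‖ ∧ ‖x‖ ≤ 3} := by
  obtain ⟨f, h0, h1, h01⟩ := exists_contMDiffMap_zero_one_of_isClosed
    (modelWithCornersSelf ℝ E3) (n := (⊤ : ℕ∞))
    (s := {x : E3 | ‖x‖ ≤ 3 / 4} ∪ {x | 3 ≤ ‖x‖}) (t := {x : E3 | 1 ≤ ‖x‖ ∧ ‖x‖ ≤ 2})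
    ((isClosed_le continuous_norm continuous_const).union
      (isClosed_le continuous_const continuous_norm))
    ((isClosed_le continuous_const continuous_norm).inter
      (isClosed_le continuous_norm continuous_const))
    (Set.disjoint_left.2 fun x hx hx' => by
      simp only [Set.mem_union, Set.mem_ofPred_eq] at hx hx'
      rcases hx with hx | hx <;> linarith)
  refine ⟨f, f.contMDiff.contDiff, h01, fun x hx hx' => h1 ⟨hx, hx'⟩, ?_⟩
  refine closure_minimal (fun x hx => ?_)
    ((isClosed_le continuous_const continuous_norm).inter
      (isClosed_le continuous_norm continuous_const))
  by_contra hcon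
  refine hx (h0 ?_)
  simp only [Set.mem_ofPred_eq, not_and_or, not_le] at hcon
  exact hcon.imp le_of_lt le_of_lt

lemma tsupport_comp_smul_subset {ψ : E3 → ℝ} {a b : ℝ}
    (hψ : tsupport ψ ⊆ {x | a ≤ ‖x‖ ∧ ‖x‖ ≤ b}) {ρ : ℝ} (hρ : 0 < ρ) :
    tsupport (fun x => ψ (ρ⁻¹ • x)) ⊆ {x | a * ρ ≤ ‖x‖ ∧ ‖x‖ ≤ b * ρ} := fun x hx => by
  have h := hψ (tsupport_comp_subset_preimage ψ (continuous_const_smul ρ⁻¹) hx)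
  simp only [Set.mem_ofPred_eq, norm_smul, norm_inv, Real.norm_of_nonneg hρ.le] at h ⊢
  rwa [inv_mul_eq_div, le_div_iff₀ hρ, div_le_iff₀ hρ] at h

lemma isOpen_exterior (R₀ : ℝ) : IsOpen {x : E3 | R₀ < ‖x‖} :=
  isOpen_lt continuous_const continuous_norm

/-- The Caccioppoli estimate on a single dyadic annulus. -/
lemma exists_lintegral_annulus_le (K : ℝ) (hK : 0 ≤ K) :
    ∃ C : ℝ, 0 ≤ C ∧
      ∀ R₀ : ℝ, 1 ≤ R₀ → ∀ n : E3 → E3,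
        ContDiffOn ℝ (⊤ : ℕ∞) n {x : E3 | R₀ < ‖x‖} →
        (∀ x : E3, R₀ < ‖x‖ → ‖n x‖ = 1) →
        (∀ x : E3, R₀ < ‖x‖ → lap3 n x = -(gradSq n x • n x)) →
        (∀ x : E3, R₀ < ‖x‖ → gradSq n x ≤ K / ‖x‖ ^ 3) →
        ∀ k : Fin 3, ∀ ρ : ℝ, 2 * R₀ ≤ ρ →
          (∫⁻ x in {x : E3 | ρ ≤ ‖x‖ ∧ ‖x‖ ≤ 2 * ρ},
              ENNReal.ofReal (gradSq (partialD n k) x)) ≤ ENNReal.ofReal (C / ρ ^ 2) := by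
  obtain ⟨ψ, hψ, h01, h1, hsupp⟩ := exists_annulus_cutoff
  have hc : HasCompactSupport ψ :=
    (isCompact_closedBall (0 : E3) 3).of_isClosed_subset (isClosed_tsupport ψ)
      fun x hx => by simpa using (hsupp hx).2
  obtain ⟨M, hM⟩ : ∃ M, ∀ x, ‖∑ i, partialD (partialD ψ i) i x‖ ≤ M := by
    choose B hB using fun i : Fin 3 =>
      ((hc.fderiv_apply ℝ (EuclideanSpace.single i (1 : ℝ))).fderiv_apply ℝ
        (EuclideanSpace.single i (1 : ℝ))).exists_bound_of_continuous
        (contDiff_partialD (contDiff_partialD hψ i) i).continuous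
    exact ⟨∑ i, B i, fun x => norm_sum_le_of_le _ fun i _ => hB i x⟩
  have hM0 : 0 ≤ M := (norm_nonneg _).trans (hM 0)
  set V := volume.real (ball (0 : E3) 1) with hV
  refine ⟨(M / 2 + 3 * K) * (3 * K) * (27 * V), by positivity, ?_⟩
  intro R₀ hR₀ n hn hunit hlap hgrad k ρ hρ
  have hρ1 : 1 ≤ ρ := by linarith
  have hρ0 : 0 < ρ := by linarith
  have hU := isOpen_exterior R₀
  set φ : E3 → ℝ := fun x => ψ (ρ⁻¹ • x) with hφ
  have hφsupp := tsupport_comp_smul_subset hsupp hρ0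
  have hφU : tsupport φ ⊆ {x : E3 | R₀ < ‖x‖} := fun x hx => by
    have := (hφsupp hx).1
    simp only [Set.mem_ofPred_eq]
    linarith
  have hφc : HasCompactSupport φ := hc.comp_smul (inv_ne_zero hρ0.ne')
  have hφs : ContDiff ℝ (⊤ : ℕ∞) φ := hψ.comp (contDiff_const_smul _)
  have hlapφ : ∀ x, ∑ i, partialD (partialD φ i) i x =
      (ρ ^ 2)⁻¹ * ∑ i, partialD (partialD ψ i) i (ρ⁻¹ • x) := fun x => by
    rw [Finset.mul_sum]
    refine Finset.sum_congr rfl fun i _ => ?_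
    have h2 : partialD φ i = fun y => ρ⁻¹ • partialD ψ i (ρ⁻¹ • y) :=
      funext fun y => partialD_comp_smul ψ ρ⁻¹ i y
    have h3 := partialD_comp_smul (fun y => ρ⁻¹ • partialD ψ i y) ρ⁻¹ i x
    rw [h2, h3]
    have h4 : partialD (fun y => ρ⁻¹ • partialD ψ i y) i (ρ⁻¹ • x) =
        ρ⁻¹ • partialD (partialD ψ i) i (ρ⁻¹ • x) := by
      simp only [partialD]
      rw [fderiv_fun_const_smul ((contDiff_partialD hψ i).differentiable (by simp) _)]
      simp
    rw [h4, smul_smul, smul_eq_mul, sq, mul_inv]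
  have hw := contDiffOn_partialD hU hn k
  have hint : Integrable fun x => φ x * gradSq (partialD n k) x :=
    integrable_mul_of_tsupport_subset hU hφs.continuous hφc hφU
      (contDiffOn_gradSq hU hw).continuousOn
  have hφ0 : ∀ x, 0 ≤ φ x * gradSq (partialD n k) x := fun x =>
    mul_nonneg (h01 _).1 (gradSq_nonneg _ _)
  set G : E3 → ℝ := fun x =>
    ((∑ i, partialD (partialD φ i) i x) / 2 + φ x * gradSq n x) * ‖partialD n k x‖ ^ 2 with hG
  have hbound : ∀ x, ‖G x‖ ≤ (M / 2 + 3 * K) * (3 * K) / ρ ^ 5 := fun x => by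
    by_cases hx : x ∈ tsupport φ
    · have hxρ : 3 / 4 * ρ ≤ ‖x‖ := (hφsupp hx).1
      have hx0 : 0 < ‖x‖ := by linarith
      have hgn : gradSq n x ≤ 3 * K / ρ ^ 3 := by
        refine (hgrad x (hφU hx)).trans ?_
        have h3 : (3 / 4 * ρ) ^ 3 ≤ ‖x‖ ^ 3 := by gcongr
        rw [div_le_div_iff₀ (by positivity) (by positivity)]
        have : K * ρ ^ 3 ≤ K * (3 * ‖x‖ ^ 3) := by
          gcongr
          nlinarith [pow_pos hρ0 3]
        linarith
      have hwn := (norm_partialD_sq_le_gradSq n k x).trans hgn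
      have hρ3 : 3 * K / ρ ^ 3 ≤ 3 * K / ρ ^ 2 := by
        gcongr
        norm_num
      have hfst : ‖(∑ i, partialD (partialD φ i) i x) / 2 + φ x * gradSq n x‖ ≤
          (M / 2 + 3 * K) / ρ ^ 2 := by
        refine (norm_add_le _ _).trans ?_
        have ha : ‖(∑ i, partialD (partialD φ i) i x) / 2‖ ≤ M / 2 / ρ ^ 2 := by
          rw [hlapφ, norm_div, norm_mul, norm_inv, norm_pow, Real.norm_of_nonneg hρ0.le,
            Real.norm_ofNat, inv_mul_eq_div, div_right_comm]
          gcongr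
          exact hM _
        have hb : ‖φ x * gradSq n x‖ ≤ 3 * K / ρ ^ 2 := by
          rw [Real.norm_of_nonneg (mul_nonneg (h01 _).1 (gradSq_nonneg _ _))]
          exact (mul_le_of_le_one_left (gradSq_nonneg _ _) (h01 _).2).trans (hgn.trans hρ3)
        rw [add_div]
        exact add_le_add ha hb
      rw [hG, norm_mul, Real.norm_of_nonneg (sq_nonneg ‖partialD n k x‖)]
      refine (mul_le_mul hfst hwn (sq_nonneg _) (by positivity)).trans_eq ?_
      field_simp
    · have h1 : φ x = 0 := image_eq_zero_of_notMem_tsupport hx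
      have h2 : ∀ i, partialD (partialD φ i) i x = 0 := fun i =>
        image_eq_zero_of_notMem_tsupport fun h =>
          hx (tsupport_partialD_subset φ i (tsupport_partialD_subset _ i h))
      simp only [hG, h1, h2, Finset.sum_const_zero, zero_div, zero_mul, add_zero, norm_zero]
      positivity
  have hG0 : ∀ x ∉ closedBall (0 : E3) (3 * ρ), G x = 0 := fun x hx => by
    have hx' : x ∉ tsupport φ := fun h => hx (by simpa using (hφsupp h).2)
    have h1 : φ x = 0 := image_eq_zero_of_notMem_tsupport hx'
    have h2 : ∀ i, partialD (partialD φ i) i x = 0 := fun i =>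
      image_eq_zero_of_notMem_tsupport fun h =>
        hx' (tsupport_partialD_subset φ i (tsupport_partialD_subset _ i h))
    simp [hG, h1, h2]
  have hvol : volume.real (closedBall (0 : E3) (3 * ρ)) = 27 * V * ρ ^ 3 := by
    rw [Measure.addHaar_real_closedBall _ _ (by positivity), hV]
    simp
    ring
  have hmain : ∫ x, φ x * gradSq (partialD n k) x ≤
      (M / 2 + 3 * K) * (3 * K) * (27 * V) / ρ ^ 2 := by
    rw [integral_mul_gradSq_partialD hU hn hunit hlap k hφs hφc hφU,
      ← setIntegral_eq_integral_of_forall_compl_eq_zero hG0]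
    refine (le_abs_self _).trans ((norm_setIntegral_le_of_norm_le_const
      measure_closedBall_lt_top fun x _ => hbound x).trans_eq ?_)
    rw [hvol]
    field_simp
  calc ∫⁻ x in {x : E3 | ρ ≤ ‖x‖ ∧ ‖x‖ ≤ 2 * ρ}, ENNReal.ofReal (gradSq (partialD n k) x)
      ≤ ∫⁻ x in {x : E3 | ρ ≤ ‖x‖ ∧ ‖x‖ ≤ 2 * ρ},
          ENNReal.ofReal (φ x * gradSq (partialD n k) x) := by
        refine setLIntegral_mono' ((isClosed_le continuous_const continuous_norm).inter
          (isClosed_le continuous_norm continuous_const)).measurableSet fun x hx => ?_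
        have : φ x = 1 := by
          apply h1 <;> rw [norm_smul, norm_inv, Real.norm_of_nonneg hρ0.le, inv_mul_eq_div]
          · exact (one_le_div hρ0).2 hx.1
          · exact (div_le_iff₀ hρ0).2 hx.2
        rw [this, one_mul]
    _ ≤ ∫⁻ x, ENNReal.ofReal (φ x * gradSq (partialD n k) x) := setLIntegral_le_lintegral _ _
    _ = ENNReal.ofReal (∫ x, φ x * gradSq (partialD n k) x) :=
        (ofReal_integral_eq_lintegral_ofReal hint (ae_of_all _ hφ0)).symm
    _ ≤ _ := ENNReal.ofReal_le_ofReal hmain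

lemma exterior_subset_iUnion_annulus {R : ℝ} (hR : 0 < R) :
    {x : E3 | R ≤ ‖x‖} ⊆ ⋃ j : ℕ, {x : E3 | 2 ^ j * R ≤ ‖x‖ ∧ ‖x‖ ≤ 2 * (2 ^ j * R)} :=
  fun x hx => by
    obtain ⟨j, hj, hj'⟩ := exists_nat_pow_near ((one_le_div hR).2 hx) one_lt_two
    rw [le_div_iff₀ hR] at hj
    rw [div_lt_iff₀ hR, pow_succ] at hj'
    exact Set.mem_iUnion.2 ⟨j, hj, by linarith⟩

lemma tsum_ofReal_dyadic {C R : ℝ} (hC : 0 ≤ C) :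
    ∑' j : ℕ, ENNReal.ofReal (C / (2 ^ j * R) ^ 2) = ENNReal.ofReal (4 / 3 * C / R ^ 2) := by
  have hs : HasSum (fun j : ℕ => C / (2 ^ j * R) ^ 2) (4 / 3 * C / R ^ 2) := by
    have hg := (hasSum_geometric_of_lt_one (r := (1 / 4 : ℝ)) (by norm_num)
      (by norm_num)).mul_left (C / R ^ 2)
    have hval : C / R ^ 2 * (1 - 1 / 4)⁻¹ = 4 / 3 * C / R ^ 2 := by ring
    have hterm : (fun j : ℕ => C / R ^ 2 * (1 / 4) ^ j) = fun j => C / (2 ^ j * R) ^ 2 := by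
      funext j
      rw [mul_pow, ← pow_mul, mul_comm j 2, pow_mul, one_div, inv_pow]
      norm_num
      ring
    rwa [hval, hterm] at hg
  rw [← ENNReal.ofReal_tsum_of_nonneg (fun j => by positivity) hs.summable, hs.tsum_eq]

/-- **Caccioppoli estimate for derivatives of harmonic maps (alternative proof of Step 1).**
Let `R₀ ≥ 1` and let `n : ℝ³∖B̄_{R₀} → S²` be a smooth solution of `−Δn = |∇n|² n` with
`|∇n(x)|² ≤ K |x|⁻³`. Then each derivative `w = ∂_k n` satisfies
`∫_{|x|≥R} |∇w|² ≤ C/R²` for all `R ≥ 2R₀`, with `C` depending only on `K`. -/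
theorem caccioppoli_derivative_decay (K : ℝ) (hK : 0 ≤ K) :
    ∃ C : ℝ, 0 < C ∧
      ∀ R₀ : ℝ, 1 ≤ R₀ → ∀ n : E3 → E3,
        ContDiffOn ℝ (⊤ : ℕ∞) n {x : E3 | R₀ < ‖x‖} →
        (∀ x : E3, R₀ < ‖x‖ → ‖n x‖ = 1) →
        (∀ x : E3, R₀ < ‖x‖ → lap3 n x = -(gradSq n x • n x)) →
        (∀ x : E3, R₀ < ‖x‖ → gradSq n x ≤ K / ‖x‖ ^ 3) →
        ∀ k : Fin 3, ∀ R : ℝ, 2 * R₀ ≤ R →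
          (∫⁻ x in {x : E3 | R ≤ ‖x‖},
              ENNReal.ofReal
                (gradSq (fun y => fderiv ℝ n y (EuclideanSpace.single k (1 : ℝ))) x))
            ≤ ENNReal.ofReal (C / R ^ 2) := by
  obtain ⟨C, hC, h⟩ := exists_lintegral_annulus_le K hK
  refine ⟨4 / 3 * C + 1, by positivity, ?_⟩
  intro R₀ hR₀ n hn hunit hlap hgrad k R hR
  have hR0 : 0 < R := by linarith
  calc ∫⁻ x in {x : E3 | R ≤ ‖x‖}, ENNReal.ofReal (gradSq (partialD n k) x)
      ≤ ∫⁻ x in ⋃ j : ℕ, {x : E3 | 2 ^ j * R ≤ ‖x‖ ∧ ‖x‖ ≤ 2 * (2 ^ j * R)},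
          ENNReal.ofReal (gradSq (partialD n k) x) :=
        lintegral_mono_set (exterior_subset_iUnion_annulus hR0)
    _ ≤ ∑' j : ℕ, ∫⁻ x in {x : E3 | 2 ^ j * R ≤ ‖x‖ ∧ ‖x‖ ≤ 2 * (2 ^ j * R)},
          ENNReal.ofReal (gradSq (partialD n k) x) := lintegral_iUnion_le _ _
    _ ≤ ∑' j : ℕ, ENNReal.ofReal (C / (2 ^ j * R) ^ 2) :=
        ENNReal.tsum_le_tsum fun j => h R₀ hR₀ n hn hunit hlap hgrad k _
          (hR.trans (le_mul_of_one_le_left hR0.le (one_le_pow₀ one_le_two)))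
    _ = ENNReal.ofReal (4 / 3 * C / R ^ 2) := tsum_ofReal_dyadic hC
    _ ≤ ENNReal.ofReal ((4 / 3 * C + 1) / R ^ 2) := by
        gcongr
        linarith

end
end
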